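/- arXiv:1104.5472 — 3 statements merged into one kernel-verified Lean document; each statement's English description precedes it below -/
import Mathlib

section
/- Let {σ₁, σ₂, σ₃} be a triad of involutions of g, i.e., σ₁, σ₂ are distinct commuting involutions, σ₃ = σ₁σ₂, and σ₁, σ₂, σ₃ are pairwise conjugate by inner automorphisms of g. Let g = g₀₀ ⊕ g₀₁ ⊕ g₁₀ ⊕ g₁₁ be the quaternionic decomposition determined by σ₁ and σ₂. Then for every permutation (α, β, γ) of the indices (01, 10, 11), any Cartan subspace of g_α is also a Cartan subspace of g_α ⊕ g_β and of g_α ⊕ g_γ. -/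
open LieAlgebra Module

variable (k : Type*) [Field k] [IsAlgClosed k] [CharZero k]
variable (g : Type*) [LieRing g] [LieAlgebra k g] [FiniteDimensional k g]
  [LieAlgebra.IsSemisimple k g]

/-- The eigenspace of a Lie algebra automorphism `σ` for the eigenvalue `c`. -/
noncomputable def eigSub (σ : g ≃ₗ⁅k⁆ g) (c : k) : Submodule k g :=
  Module.End.eigenspace (σ.toLinearEquiv : g →ₗ[k] g) c

/-- A Lie algebra involution: an automorphism `σ` with `σ ∘ σ = id`. -/
def IsInvolution (σ : g ≃ₗ⁅k⁆ g) : Prop := ∀ x, σ (σ x) = x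

/-- Two commuting involutions. -/
def CommutingInvolutions (σ₁ σ₂ : g ≃ₗ⁅k⁆ g) : Prop :=
  IsInvolution k g σ₁ ∧ IsInvolution k g σ₂ ∧ ∀ x, σ₁ (σ₂ x) = σ₂ (σ₁ x)

/-- The subspace `g_{ij}` of the quaternionic decomposition determined by commuting
involutions `σ₁, σ₂`: here `i, j : Bool` and `false, true` encode the exponents `0, 1`
of the eigenvalues `(-1)^i`, `(-1)^j`. -/
noncomputable def qSpace (σ₁ σ₂ : g ≃ₗ⁅k⁆ g) (i j : Bool) : Submodule k g :=
  eigSub k g σ₁ (if i then -1 else 1) ⊓ eigSub k g σ₂ (if j then -1 else 1)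

/-- `x` is a semisimple element of `g`: `ad x` is a semisimple endomorphism. -/
def IsSSElt (x : g) : Prop := Module.End.IsSemisimple (ad k g x)

/-- `x` is a nilpotent element of `g`: `ad x` is a nilpotent endomorphism. -/
def IsNilpElt (x : g) : Prop := IsNilpotent (ad k g x)

/-- `x` is a regular element of `g`: the dimension of its centralizer equals the rank of `g`,
i.e. the dimension of a Cartan subalgebra of `g`. -/
def IsRegElt (x : g) : Prop :=
  ∃ H : LieSubalgebra k g, H.IsCartanSubalgebra ∧
    Module.finrank k (LinearMap.ker (ad k g x)) = Module.finrank k H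

/-- An involution is of maximal rank if its `(-1)`-eigenspace contains a Cartan
subalgebra of `g`. -/
def IsMaxRank (σ : g ≃ₗ⁅k⁆ g) : Prop :=
  ∃ H : LieSubalgebra k g, H.IsCartanSubalgebra ∧ H.toSubmodule ≤ eigSub k g σ (-1)

/-- The centralizer of an element `x`, as a Lie subalgebra of `g`. -/
def zg (x : g) : LieSubalgebra k g where
  carrier := {y | ⁅x, y⁆ = 0}
  add_mem' := by
    intro a b ha hb
    simp only [Set.mem_setOf_eq] at *
    rw [lie_add, ha, hb, add_zero]
  zero_mem' := by simp
  smul_mem' := by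
    intro t a ha
    simp only [Set.mem_setOf_eq] at *
    rw [lie_smul, ha, smul_zero]
  lie_mem' := by
    intro a b ha hb
    simp only [Set.mem_setOf_eq] at *
    rw [leibniz_lie, ha, hb, lie_zero, zero_lie, add_zero]

/-- The fixed-point subalgebra of a Lie algebra automorphism. -/
def fixSubalgebra (σ : g ≃ₗ⁅k⁆ g) : LieSubalgebra k g where
  carrier := {x | σ x = x}
  add_mem' := by
    intro a b ha hb
    simp only [Set.mem_setOf_eq] at *
    rw [show σ (a + b) = σ a + σ b from σ.toLieHom.map_add a b, ha, hb]
  zero_mem' := by simp only [Set.mem_setOf_eq]; exact σ.toLieHom.map_zero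
  smul_mem' := by
    intro t a ha
    simp only [Set.mem_setOf_eq] at *
    rw [show σ (t • a) = t • σ a from σ.toLieHom.map_smul t a, ha]
  lie_mem' := by
    intro a b ha hb
    simp only [Set.mem_setOf_eq] at *
    rw [LieEquiv.map_lie σ a b, ha, hb]

/-- The exponential of an endomorphism, as a finite sum (which is the genuine exponential
when the endomorphism is nilpotent). -/
noncomputable def expEnd (f : Module.End k g) : Module.End k g :=
  ∑ i ∈ Finset.range (Module.finrank k g + 1), (i.factorial : k)⁻¹ • f ^ i

/-- An automorphism of `g` is inner if it lies in the subgroup of automorphisms generated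
by the exponentials `exp (ad x)` with `ad x` nilpotent. -/
noncomputable def IsInnerAut (μ : g ≃ₗ⁅k⁆ g) : Prop :=
  μ.toLinearEquiv ∈ Subgroup.closure
    {e : g ≃ₗ[k] g | ∃ x : g, IsNilpotent (ad k g x) ∧
      (e : g →ₗ[k] g) = expEnd k g (ad k g x)}

/-- `σ` and `τ` are conjugate by an inner automorphism of `g`. -/
noncomputable def InnerConj (σ τ : g ≃ₗ⁅k⁆ g) : Prop :=
  ∃ φ : g ≃ₗ⁅k⁆ g, IsInnerAut k g φ ∧ ∀ x, τ x = φ (σ (φ.symm x))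

/-- A dyad: a pair of distinct commuting involutions that are conjugate by an inner
automorphism of `g`. -/
noncomputable def IsDyad (σ₁ σ₂ : g ≃ₗ⁅k⁆ g) : Prop :=
  IsInvolution k g σ₁ ∧ IsInvolution k g σ₂ ∧ σ₁ ≠ σ₂ ∧
    (∀ x, σ₁ (σ₂ x) = σ₂ (σ₁ x)) ∧ InnerConj k g σ₁ σ₂

/-- The span of all brackets `⁅x, y⁆` with `x, y` in a subspace `m`. -/
noncomputable def bracketSpan (m : Submodule k g) : Submodule k g :=
  Submodule.span k {z | ∃ x ∈ m, ∃ y ∈ m, z = ⁅x, y⁆}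

/-- `c` is a Cartan subspace of a subspace `m ⊆ g`: it consists of pairwise commuting
semisimple elements of `g` and is maximal among such subspaces of `m`. -/
def IsCartanSubspace (m c : Submodule k g) : Prop :=
  c ≤ m ∧ (∀ x ∈ c, IsSSElt k g x) ∧ (∀ x ∈ c, ∀ y ∈ c, ⁅x, y⁆ = 0) ∧
    ∀ c' : Submodule k g, c' ≤ m → (∀ x ∈ c', IsSSElt k g x) →
      (∀ x ∈ c', ∀ y ∈ c', ⁅x, y⁆ = 0) → c ≤ c' → c' = c



section P1a
open Polynomial

lemma aux_derivative_det {F : Type*} [Field F] {n : Type*} [Fintype n] [DecidableEq n]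
    (M : Matrix n n F[X]) :
    derivative M.det = (M.adjugate * M.map derivative).trace := by
  have h1 : derivative M.det = ∑ i, (M.updateRow i (fun j => derivative (M i j))).det := by
    simp only [← Matrix.det_transpose M, ← Matrix.det_transpose (Matrix.updateRow _ _ _)]
    simp only [Matrix.det_apply, map_sum]
    rw [Finset.sum_comm]
    refine Finset.sum_congr rfl fun σ _ => ?_
    rw [← Finset.smul_sum]
    rw [Units.smul_def, Units.smul_def, map_zsmul]
    congr 1
    rw [Polynomial.derivative_prod_finset]
    refine Finset.sum_congr rfl fun i _ => ?_
    rw [← Finset.prod_erase_mul _ _ (Finset.mem_univ i)]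
    congr 1
    · refine Finset.prod_congr rfl fun j hj => ?_
      have : i ≠ j := (Finset.ne_of_mem_erase hj).symm
      simp [Matrix.updateRow_apply, this.symm, Matrix.transpose_apply]
    · simp [Matrix.transpose_apply]
  rw [h1, Matrix.trace_mul_comm]
  simp only [Matrix.trace, Matrix.diag, Matrix.mul_apply]
  refine Finset.sum_congr rfl fun i _ => ?_
  rw [← Matrix.cramer_transpose_apply, Matrix.cramer_eq_adjugate_mulVec, Matrix.mulVec,
    dotProduct]
  refine Finset.sum_congr rfl fun j _ => ?_
  rw [← Matrix.adjugate_transpose, Matrix.transpose_apply, mul_comm, Matrix.map_apply]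

lemma aux_det_ode {F : Type*} [Field F] {n : Type*} [Fintype n] [DecidableEq n]
    (M A : Matrix n n F[X]) (δ : F[X])
    (h : δ • M.map derivative = A.transpose * M + M * A) :
    δ * derivative M.det = 2 * A.trace * M.det := by
  rw [aux_derivative_det, ← smul_eq_mul, ← Matrix.trace_smul, ← Matrix.mul_smul, h, Matrix.mul_add,
    Matrix.trace_add, ← Matrix.mul_assoc, ← Matrix.mul_assoc, Matrix.adjugate_mul,
    Matrix.trace_mul_comm, ← Matrix.mul_assoc, Matrix.mul_adjugate]
  simp [Matrix.trace_smul, Matrix.trace_transpose]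
  ring

lemma aux_ode_zero {F : Type*} [Field F] [CharZero F] (δ p G : F[X]) (hδ : δ.eval 0 ≠ 0)
    (h : δ * derivative G = p * G) (h0 : G.eval 0 = 0) : G = 0 := by
  by_contra hG
  obtain ⟨q, hq, hnd⟩ := Polynomial.exists_eq_pow_rootMultiplicity_mul_and_not_dvd G hG 0
  set n := G.rootMultiplicity 0 with hn
  have hnpos : 0 < n := (Polynomial.rootMultiplicity_pos hG).2 h0
  obtain ⟨m, hm⟩ : ∃ m, n = m + 1 := ⟨n - 1, by omega⟩
  rw [hm] at hq
  simp only [map_zero, sub_zero] at hq hnd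
  have hq0 : q.eval 0 ≠ 0 := by
    intro hc
    apply hnd
    rw [Polynomial.X_dvd_iff, Polynomial.coeff_zero_eq_eval_zero, hc]
  rw [hq] at h
  have h2 : (X : F[X]) ^ m * (δ * (((m : F[X]) + 1) * q + X * derivative q)) = X ^ m * (p * X * q) := by
    have : derivative ((X : F[X]) ^ (m+1) * q) = X ^ m * ((((m : F[X]) + 1) * q + X * derivative q)) := by
      simp [Polynomial.derivative_mul]; ring
    rw [this] at h
    linear_combination h
  have h3 := mul_left_cancel₀ (pow_ne_zero m Polynomial.X_ne_zero) h2
  have h4 := congrArg (Polynomial.eval 0) h3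
  simp at h4
  rcases h4 with h4 | h4 | h4
  · exact hδ h4
  · exact (Nat.cast_add_one_ne_zero m h4).elim
  · exact hq0 h4
end P1a

section P1b
open Polynomial TensorProduct

def TW (F : Type*) [Field F] (L : Type*) [LieRing L] [LieAlgebra F L] : Type _ := F[X] ⊗[F] L

noncomputable instance TW.i1 (F : Type*) [Field F] (L : Type*) [LieRing L] [LieAlgebra F L] :
    LieRing (TW F L) := inferInstanceAs (LieRing (F[X] ⊗[F] L))

noncomputable instance TW.i2 (F : Type*) [Field F] (L : Type*) [LieRing L] [LieAlgebra F L] :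
    LieAlgebra F[X] (TW F L) := inferInstanceAs (LieAlgebra F[X] (F[X] ⊗[F] L))

variable {F : Type*} [Field F] {L : Type*} [LieRing L] [LieAlgebra F L]

noncomputable def TW.mk (p : F[X]) (x : L) : TW F L := p ⊗ₜ[F] x

lemma TW.ind {P : TW F L → Prop} (h0 : P 0) (h1 : ∀ p x, P (TW.mk p x))
    (h2 : ∀ a b, P a → P b → P (a + b)) (v : TW F L) : P v :=
  TensorProduct.induction_on (motive := P) v h0 h1 h2

lemma TW.lie_mk (p q : F[X]) (x y : L) : ⁅TW.mk p x, TW.mk q y⁆ = TW.mk (p * q) ⁅x, y⁆ :=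
  LieAlgebra.ExtendScalars.bracket_tmul F F[X] L L p q x y

lemma TW.smul_mk (p q : F[X]) (x : L) : p • TW.mk q x = TW.mk (p * q) x :=
  TensorProduct.smul_tmul' p q x

lemma TW.mk_add (p : F[X]) (x y : L) : TW.mk p (x + y) = TW.mk p x + TW.mk p y :=
  TensorProduct.tmul_add p x y

lemma TW.add_mk (p q : F[X]) (x : L) : TW.mk (p + q) x = TW.mk p x + TW.mk q x :=
  TensorProduct.add_tmul p q x

lemma TW.mk_smul (c : F) (p : F[X]) (x : L) : TW.mk p (c • x) = C c • TW.mk p x := by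
  rw [TW.smul_mk, ← Polynomial.smul_eq_C_mul]
  exact TensorProduct.tmul_smul c p x

lemma TW.mk_zero (p : F[X]) : TW.mk p (0 : L) = 0 :=
  TensorProduct.tmul_zero _ p

/-- base change of a linear map -/
noncomputable def TW.bc (f : L →ₗ[F] L) : TW F L →ₗ[F[X]] TW F L :=
  (LinearMap.baseChange F[X] f : F[X] ⊗[F] L →ₗ[F[X]] F[X] ⊗[F] L)

lemma TW.bc_mk (f : L →ₗ[F] L) (p : F[X]) (x : L) : TW.bc f (TW.mk p x) = TW.mk p (f x) :=
  LinearMap.baseChange_tmul f p x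

noncomputable def TW.form (B : LinearMap.BilinForm F L) : LinearMap.BilinForm F[X] (TW F L) :=
  (LinearMap.BilinForm.baseChange F[X] B : LinearMap.BilinForm F[X] (F[X] ⊗[F] L))

lemma TW.form_mk (B : LinearMap.BilinForm F L) (p q : F[X]) (x y : L) :
    TW.form B (TW.mk p x) (TW.mk q y) = C (B x y) * (p * q) := by
  rw [← Polynomial.smul_eq_C_mul]
  exact LinearMap.BilinForm.baseChange_tmul B p x q y

noncomputable def tD (F : Type*) [Field F] (L : Type*) [LieRing L] [LieAlgebra F L] :
    TW F L →+ TW F L :=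
  (LinearMap.rTensor L (Polynomial.derivative : F[X] →ₗ[F] F[X])).toAddMonoidHom

noncomputable def tEv (L : Type*) [LieRing L] [LieAlgebra F L] (a : F) :
    TW F L →+ L :=
  ((TensorProduct.lid F L).toLinearMap ∘ₗ LinearMap.rTensor L (Polynomial.leval a)).toAddMonoidHom

lemma tD_mk (p : F[X]) (x : L) : tD F L (TW.mk p x) = TW.mk (derivative p) x :=
  LinearMap.rTensor_tmul L (Polynomial.derivative : F[X] →ₗ[F] F[X]) x p

lemma tEv_mk (a : F) (p : F[X]) (x : L) : tEv L a (TW.mk p x) = p.eval a • x := by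
  have : tEv L a (TW.mk p x) =
    (TensorProduct.lid F L) (LinearMap.rTensor L (Polynomial.leval a) (p ⊗ₜ[F] x)) := rfl
  rw [this]; simp

lemma tD_smul (p : F[X]) (v : TW F L) :
    tD F L (p • v) = derivative p • v + p • tD F L v := by
  induction v using TW.ind with
  | h0 => simp
  | h1 q x => simp only [TW.smul_mk, tD_mk, Polynomial.derivative_mul, TW.add_mk]
  | h2 a b ha hb => simp only [smul_add, map_add, ha, hb]; abel

lemma tEv_smul (a : F) (p : F[X]) (v : TW F L) :
    tEv L a (p • v) = p.eval a • tEv L a v := by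
  induction v using TW.ind with
  | h0 => simp
  | h1 q x => simp [TW.smul_mk, tEv_mk, mul_smul]
  | h2 a b ha hb => simp only [smul_add, map_add, ha, hb]

lemma tD_lie (v w : TW F L) : tD F L ⁅v, w⁆ = ⁅tD F L v, w⁆ + ⁅v, tD F L w⁆ := by
  induction v using TW.ind with
  | h0 => simp
  | h2 a b ha hb => simp only [add_lie, map_add, ha, hb]; abel
  | h1 p x =>
    induction w using TW.ind with
    | h0 => simp
    | h2 a b ha hb => simp only [lie_add, map_add, ha, hb]; abel
    | h1 q y =>
      simp only [TW.lie_mk, tD_mk, Polynomial.derivative_mul, TW.add_mk]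

lemma tEv_lie (a : F) (v w : TW F L) : tEv L a ⁅v, w⁆ = ⁅tEv L a v, tEv L a w⁆ := by
  induction v using TW.ind with
  | h0 => simp
  | h2 a b ha hb => simp only [add_lie, map_add, ha, hb]
  | h1 p x =>
    induction w using TW.ind with
    | h0 => simp
    | h2 a b ha hb => simp only [lie_add, map_add, ha, hb]
    | h1 q y =>
      simp only [TW.lie_mk, tEv_mk, Polynomial.eval_mul, smul_lie, lie_smul, smul_smul]
      rw [mul_comm]

lemma tD_form (B : LinearMap.BilinForm F L) (v w : TW F L) :
    derivative (TW.form B v w) = TW.form B (tD F L v) w + TW.form B v (tD F L w) := by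
  induction v using TW.ind with
  | h0 => simp
  | h2 a b ha hb => simp only [LinearMap.add_apply, map_add, ha, hb]; abel
  | h1 p x =>
    induction w using TW.ind with
    | h0 => simp
    | h2 a b ha hb => simp only [map_add, ha, hb]; abel
    | h1 q y =>
      simp only [TW.form_mk, tD_mk, Polynomial.derivative_mul, Polynomial.derivative_C]
      ring

lemma tEv_form (B : LinearMap.BilinForm F L) (t : F) (v w : TW F L) :
    (TW.form B v w).eval t = B (tEv L t v) (tEv L t w) := by
  induction v using TW.ind with
  | h0 => simp
  | h2 a b ha hb => simp only [LinearMap.add_apply, map_add, ha, hb, Polynomial.eval_add]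
  | h1 p x =>
    induction w using TW.ind with
    | h0 => simp
    | h2 a b ha hb => simp only [map_add, ha, hb, Polynomial.eval_add]
    | h1 q y =>
      simp [TW.form_mk, tEv_mk]
      ring

def IsCurve (e : L ≃ₗ[F] L) : Prop :=
  ∃ (Φ : TW F L ≃ₗ⁅F[X]⁆ TW F L) (A : TW F L),
    (∀ v, tD F L (Φ v) = Φ (tD F L v) + ⁅A, Φ v⁆) ∧
    (∀ v, tEv L 0 (Φ v) = tEv L 0 v) ∧ (∀ v, tEv L 1 (Φ v) = e (tEv L 1 v))

lemma IsCurve.one : IsCurve (1 : L ≃ₗ[F] L) :=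
  ⟨LieEquiv.refl, 0, by simp, by simp, by simp⟩

lemma lieEquiv_add {R V : Type*} [CommRing R] [LieRing V] [LieAlgebra R V] (Φ : V ≃ₗ⁅R⁆ V)
    (a b : V) : Φ (a + b) = Φ a + Φ b := Φ.toLieHom.map_add a b

lemma lieEquiv_neg {R V : Type*} [CommRing R] [LieRing V] [LieAlgebra R V] (Φ : V ≃ₗ⁅R⁆ V)
    (a : V) : Φ (-a) = - Φ a := Φ.toLieHom.map_neg a

lemma lieEquiv_sub {R V : Type*} [CommRing R] [LieRing V] [LieAlgebra R V] (Φ : V ≃ₗ⁅R⁆ V)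
    (a b : V) : Φ (a - b) = Φ a - Φ b := Φ.toLieHom.map_sub a b

lemma lieEquiv_smul {R V : Type*} [CommRing R] [LieRing V] [LieAlgebra R V] (Φ : V ≃ₗ⁅R⁆ V)
    (r : R) (a : V) : Φ (r • a) = r • Φ a := Φ.toLieHom.map_smul r a

lemma IsCurve.mul {e e' : L ≃ₗ[F] L} (h : IsCurve e) (h' : IsCurve e') : IsCurve (e * e') := by
  obtain ⟨Φ, A, h1, h2, h3⟩ := h
  obtain ⟨Ψ, B, k1, k2, k3⟩ := h'
  refine ⟨Ψ.trans Φ, A + Φ B, fun v => ?_, fun v => ?_, fun v => ?_⟩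
  · simp only [LieEquiv.trans_apply, h1, k1, add_lie, lieEquiv_add, LieEquiv.map_lie]
    abel
  · simp [h2, k2]
  · simp [h3, k3]

lemma IsCurve.inv {e : L ≃ₗ[F] L} (h : IsCurve e) : IsCurve e⁻¹ := by
  obtain ⟨Φ, A, h1, h2, h3⟩ := h
  refine ⟨Φ.symm, - Φ.symm A, fun v => ?_, fun v => ?_, fun v => ?_⟩
  · apply Φ.injective
    change Φ _ = Φ _
    have := h1 (Φ.symm v)
    simp only [LieEquiv.apply_symm_apply] at this
    simp only [lieEquiv_add, lieEquiv_neg, LieEquiv.map_lie, LieEquiv.apply_symm_apply, neg_lie,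
      this]
    abel
  · rw [← h2]; simp
  · have := h3 (Φ.symm v)
    simp only [LieEquiv.apply_symm_apply] at this
    rw [this]
    exact (e.symm_apply_apply _).symm

lemma IsCurve.exp [CharZero F] {e : L ≃ₗ[F] L} (x : L) (N : ℕ)
    (hx : (ad F L x) ^ N = 0)
    (he : (e : L →ₗ[F] L) = ∑ i ∈ Finset.range (N + 1), (i.factorial : F)⁻¹ • (ad F L x) ^ i) :
    IsCurve e := by
  let _i1 : Module ℚ (TW F L) := Module.compHom _ ((C : F →+* F[X]).comp (algebraMap ℚ F))
  have qs : ∀ (q : ℚ) (v : TW F L), q • v = (C (algebraMap ℚ F q) : F[X]) • v := fun q v => rfl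
  let _i2 : LieAlgebra ℚ (TW F L) := { lie_smul := by intro t a b; simp only [qs, lie_smul] }
  set D : LieDerivation F[X] (TW F L) (TW F L) := LieDerivation.ad F[X] (TW F L) (TW.mk X x) with hD
  have hDa : ∀ v : TW F L, D.toLinearMap v = ⁅TW.mk (X : F[X]) x, v⁆ := fun v => by
    exact LieDerivation.ad_apply_apply _ _ _ _
  have hDX : ∀ v : TW F L, D.toLinearMap v = (X : F[X]) • ⁅TW.mk (1 : F[X]) x, v⁆ := fun v => by
    rw [hDa, ← smul_lie, TW.smul_mk, mul_one]
  have hpow : ∀ (n : ℕ) (p : F[X]) (y : L), (D.toLinearMap ^ n) (TW.mk p y) =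
      TW.mk (X ^ n * p) (((ad F L x) ^ n) y) := by
    intro n p y
    induction n with
    | zero => simp
    | succ n ih =>
      rw [pow_succ', Module.End.mul_apply, ih, hDa, TW.lie_mk,
        pow_succ' (ad F L x), Module.End.mul_apply, ad_apply, pow_succ', mul_assoc]
  have hN0 : D.toLinearMap ^ N = 0 := by
    ext v
    induction v using TW.ind with
    | h0 => simp
    | h1 p y => rw [hpow, hx]; simp [TW.mk_zero]
    | h2 a b ha hb => rw [map_add, ha, hb]; simp
  have hN : D.toLinearMap ^ (N+1) = 0 := by rw [pow_succ, hN0, zero_mul]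
  have hnil : IsNilpotent D.toLinearMap := ⟨N+1, hN⟩
  have happ : ∀ v, D.exp hnil v =
      ∑ i ∈ Finset.range (N+1), (C (i.factorial : F)⁻¹ : F[X]) • (D.toLinearMap ^ i) v := by
    intro v
    rw [LieDerivation.exp_map_apply, IsNilpotent.exp_eq_sum hN, LinearMap.sum_apply]
    refine Finset.sum_congr rfl fun i _ => ?_
    rw [LinearMap.smul_apply, qs]
    simp
  have hDpow : ∀ (n : ℕ) (v : TW F L), tD F L ((D.toLinearMap ^ (n+1)) v) =
      (D.toLinearMap ^ (n+1)) (tD F L v) + ((n : F[X]) + 1) • ⁅TW.mk (1 : F[X]) x, (D.toLinearMap ^ n) v⁆ := by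
    intro n v
    have base : ∀ v, tD F L (D.toLinearMap v) = D.toLinearMap (tD F L v) + ⁅TW.mk (1 : F[X]) x, v⁆ := by
      intro v
      rw [hDa, tD_lie, tD_mk, derivative_X, hDa, add_comm]
    induction n with
    | zero => simpa using base v
    | succ n ih =>
      rw [pow_succ' _ (n+1), Module.End.mul_apply, base, ih, Module.End.mul_apply, map_add,
        map_smul]
      have : D.toLinearMap ⁅TW.mk (1 : F[X]) x, (D.toLinearMap ^ n) v⁆ = ⁅TW.mk (1 : F[X]) x, (D.toLinearMap ^ (n+1)) v⁆ := by
        rw [hDX, ← lie_smul, ← hDX, pow_succ', Module.End.mul_apply]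
      rw [this]
      push_cast
      module
  refine ⟨D.exp hnil, TW.mk (1 : F[X]) x, fun v => ?_, fun v => ?_, fun v => ?_⟩
  · rw [happ, happ, map_sum]
    simp only [tD_smul, derivative_C, zero_smul, zero_add]
    rw [Finset.sum_range_succ', Finset.sum_range_succ']
    simp only [hDpow]
    have h1 : ∑ i ∈ Finset.range (N+1), (C (i.factorial : F)⁻¹ : F[X]) • (D.toLinearMap ^ i) v =
        ∑ i ∈ Finset.range N, (C (i.factorial : F)⁻¹ : F[X]) • (D.toLinearMap ^ i) v := by
      rw [Finset.sum_range_succ, hN0]; simp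
    rw [h1, lie_sum]
    simp only [smul_add, Finset.sum_add_distrib]
    have h2 : ∀ n : ℕ, (C ((n+1).factorial : F)⁻¹ : F[X]) • ((n : F[X]) + 1) •
        ⁅TW.mk (1 : F[X]) x, (D.toLinearMap ^ n) v⁆ =
        ⁅TW.mk (1 : F[X]) x, (C (n.factorial : F)⁻¹ : F[X]) • (D.toLinearMap ^ n) v⁆ := by
      intro n
      rw [lie_smul, smul_smul]
      congr 1
      have : ((n : F[X]) + 1) = C ((n : F) + 1) := by simp
      rw [this, ← C_mul]
      congr 1
      rw [Nat.factorial_succ]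
      have : ((n : F) + 1) ≠ 0 := Nat.cast_add_one_ne_zero n
      have : ((n.factorial : ℕ) : F) ≠ 0 := by exact_mod_cast Nat.factorial_ne_zero n
      push_cast
      field_simp
    simp only [h2]
    simp only [pow_zero, Module.End.one_apply]
    abel
  · rw [happ, map_sum, Finset.sum_range_succ', Finset.sum_eq_zero]
    · simp
    · intro i _
      rw [tEv_smul, pow_succ', Module.End.mul_apply, hDX, tEv_smul]; simp
  · rw [happ, map_sum]
    have : e (tEv L 1 v) = (e : L →ₗ[F] L) (tEv L 1 v) := rfl
    rw [this, he, LinearMap.sum_apply]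
    refine Finset.sum_congr rfl fun i hi => ?_
    clear hi
    rw [tEv_smul, eval_C, LinearMap.smul_apply]
    congr 1
    induction i with
    | zero => simp
    | succ n ih =>
      rw [pow_succ', Module.End.mul_apply, hDa, tEv_lie, ih, tEv_mk, pow_succ',
        Module.End.mul_apply, ad_apply]
      simp
end P1b

section P1c
open Polynomial TensorProduct

variable {F : Type*} [Field F] {L : Type*} [LieRing L] [LieAlgebra F L]

noncomputable def TW.basis {ι : Type*} (b : Basis ι F L) : Basis ι F[X] (TW F L) :=
  (Algebra.TensorProduct.basis F[X] b : Basis ι F[X] (F[X] ⊗[F] L))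

lemma TW.basis_apply {ι : Type*} (b : Basis ι F L) (i : ι) :
    TW.basis b i = TW.mk (1 : F[X]) (b i) :=
  Algebra.TensorProduct.basis_apply b i

lemma TW.basis_repr {ι : Type*} (b : Basis ι F L) (i : ι) (t : F) (v : TW F L) :
    ((TW.basis b).repr v i).eval t = b.repr (tEv L t v) i := by
  induction v using TW.ind with
  | h0 => simp
  | h2 a c ha hc => simp only [map_add, Finsupp.add_apply, eval_add, ha, hc]
  | h1 p x =>
    have : (TW.basis b).repr (TW.mk p x) = p • Finsupp.mapRange (algebraMap F F[X]) (by simp) (b.repr x) :=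
      Algebra.TensorProduct.basis_repr_tmul b p x
    rw [this, tEv_mk]
    simp

lemma TW.exists_solve [FiniteDimensional F L] (T : TW F L →ₗ[F[X]] TW F L)
    (hT : ∀ x : L, tEv L 0 (T (TW.mk 1 x)) = x) (A : TW F L) :
    ∃ (δ : F[X]) (Y : TW F L), δ.eval 0 = 1 ∧ T Y = δ • A := by
  classical
  set b := Module.finBasis F L
  set M := LinearMap.toMatrix (TW.basis b) (TW.basis b) T with hM
  refine ⟨M.det, (TW.basis b).equivFun.symm (M.adjugate.mulVec ((TW.basis b).equivFun A)), ?_, ?_⟩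
  · have h1 : M.det.eval 0 = (M.map (evalRingHom (0:F))).det := by
      rw [← coe_evalRingHom, RingHom.map_det]; rfl
    have h2 : M.map (evalRingHom (0:F)) = 1 := by
      ext i j
      rw [Matrix.map_apply, hM, LinearMap.toMatrix_apply, coe_evalRingHom, TW.basis_repr,
        TW.basis_apply, hT, Basis.repr_self, Matrix.one_apply, Finsupp.single_apply]
      simp [eq_comm]
    rw [h1, h2, Matrix.det_one]
  · apply (TW.basis b).equivFun.injective
    have h3 : ∀ Y, (TW.basis b).equivFun (T Y) = M.mulVec ((TW.basis b).equivFun Y) := by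
      intro Y
      exact (LinearMap.toMatrix_mulVec_repr (TW.basis b) (TW.basis b) T Y).symm
    rw [h3, LinearEquiv.apply_symm_apply, Matrix.mulVec_mulVec, Matrix.mul_adjugate,
      Matrix.smul_mulVec, Matrix.one_mulVec, map_smul]

lemma core_lemma [CharZero F] [FiniteDimensional F L] (B : LinearMap.BilinForm F L)
    (K P : Submodule F L) (hKP : K ⊔ P = ⊤)
    (hB : ∀ x ∈ K, ∀ v w, B ⁅x, v⁆ w + B v ⁅x, w⁆ = 0)
    {n : Type*} [Fintype n] [DecidableEq n] (b : n → L)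
    (hb : ∀ x ∈ P, ∀ i, ⁅x, b i⁆ ∈ Submodule.span F (Set.range b))
    (e : L ≃ₗ[F] L) (he : IsCurve e)
    (hdet : (Matrix.of fun i j => B (e (b i)) (e (b j))).det ≠ 0) :
    (Matrix.of fun i j => B (b i) (b j)).det ≠ 0 := by
  obtain ⟨Φ, A, hΦ, hΦ0, hΦ1⟩ := he
  obtain ⟨κ, π, hκ, hπ, hκπ⟩ : ∃ κ π : L →ₗ[F] L, (∀ x, κ x ∈ K) ∧ (∀ x, π x ∈ P) ∧
      ∀ x, κ x + π x = x := by
    have hsurj : LinearMap.range (LinearMap.coprod K.subtype P.subtype) = ⊤ := by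
      rw [LinearMap.range_coprod]; simpa using hKP
    obtain ⟨s, hs⟩ := LinearMap.exists_rightInverse_of_surjective _ hsurj
    refine ⟨K.subtype ∘ₗ LinearMap.fst F _ _ ∘ₗ s, P.subtype ∘ₗ LinearMap.snd F _ _ ∘ₗ s,
      fun x => by simp, fun x => by simp, fun x => ?_⟩
    have := LinearMap.congr_fun hs x
    simpa using this
  set T : TW F L →ₗ[F[X]] TW F L := TW.bc κ + (Φ : TW F L →ₗ[F[X]] TW F L) ∘ₗ TW.bc π with hT
  have hTa : ∀ v, T v = TW.bc κ v + Φ (TW.bc π v) := fun v => rfl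
  obtain ⟨δ, Y, hδ, hY⟩ := TW.exists_solve T (by
    intro x
    rw [hTa, map_add, TW.bc_mk, TW.bc_mk, hΦ0, tEv_mk, tEv_mk]
    simpa using hκπ x) A
  have hK : ∀ Z v w : TW F L, TW.form B ⁅TW.bc κ Z, v⁆ w + TW.form B v ⁅TW.bc κ Z, w⁆ = 0 := by
    intro Z v w
    induction Z using TW.ind with
    | h0 => simp
    | h2 c d hc hd =>
      simp only [map_add, add_lie, LinearMap.add_apply]
      linear_combination hc + hd
    | h1 p x =>
      rw [TW.bc_mk]
      induction v using TW.ind with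
      | h0 => simp
      | h2 c d hc hd =>
        simp only [map_add, lie_add, LinearMap.add_apply]
        linear_combination hc + hd
      | h1 q y =>
        induction w using TW.ind with
        | h0 => simp
        | h2 c d hc hd =>
          simp only [map_add, lie_add]
          linear_combination hc + hd
        | h1 r z =>
          rw [TW.lie_mk, TW.lie_mk, TW.form_mk, TW.form_mk]
          have h1 := congrArg (C : F → F[X]) (hB (κ x) (hκ x) y z)
          rw [C_add, C_0] at h1
          linear_combination (p * q * r) * h1
  have hP : ∀ (Z : TW F L) (i : n), ∃ a : n → F[X],
      ⁅TW.bc π Z, TW.mk (1 : F[X]) (b i)⁆ = ∑ l, a l • TW.mk (1 : F[X]) (b l) := by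
    intro Z i
    induction Z using TW.ind with
    | h0 => exact ⟨0, by simp⟩
    | h2 c d hc hd =>
      obtain ⟨a, ha⟩ := hc
      obtain ⟨a', ha'⟩ := hd
      refine ⟨a + a', ?_⟩
      simp only [map_add, add_lie, ha, ha', Pi.add_apply, add_smul, Finset.sum_add_distrib]
    | h1 p x =>
      obtain ⟨a, ha⟩ := (Submodule.mem_span_range_iff_exists_fun F).1 (hb (π x) (hπ x) i)
      refine ⟨fun l => C (a l) * p, ?_⟩
      rw [TW.bc_mk, TW.lie_mk, ← ha, mul_one]
      have : ∀ s : Finset n, TW.mk p (∑ l ∈ s, a l • b l) =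
          ∑ l ∈ s, (C (a l) * p) • TW.mk (1 : F[X]) (b l) := by
        intro s
        induction s using Finset.induction_on with
        | empty => simp [TW.mk_zero]
        | insert c s hc ih =>
          rw [Finset.sum_insert hc, Finset.sum_insert hc, TW.mk_add, ih, TW.mk_smul, TW.smul_mk,
            TW.smul_mk, mul_one]
      exact this _
  choose a ha using hP Y
  set w : n → TW F L := fun i => Φ (TW.mk (1 : F[X]) (b i)) with hw
  set M : Matrix n n F[X] := Matrix.of fun i j => TW.form B (w i) (w j) with hM
  have hwD : ∀ i, δ • tD F L (w i) = ⁅TW.bc κ Y, w i⁆ + ∑ l, a i l • w l := by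
    intro i
    have h1 : tD F L (w i) = ⁅A, w i⁆ := by
      simp only [hw, hΦ, tD_mk, derivative_one]
      have : TW.mk (0 : F[X]) (b i) = 0 := TensorProduct.zero_tmul _ _
      rw [this]
      simp
    rw [h1, ← smul_lie, ← hY, hTa, add_lie]
    congr 1
    simp only [hw]
    rw [← LieEquiv.map_lie, ha]
    have h2 : ∀ v, Φ v = (Φ : TW F L →ₗ[F[X]] TW F L) v := fun v => rfl
    simp only [h2, map_sum, map_smul]
  have hode : δ • M.map derivative =
      (Matrix.of fun l i => a i l).transpose * M + M * (Matrix.of fun l i => a i l) := by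
    ext1 i j
    rw [Matrix.smul_apply, Matrix.map_apply, Matrix.add_apply, Matrix.mul_apply, Matrix.mul_apply]
    simp only [hM, Matrix.of_apply, Matrix.transpose_apply]
    rw [tD_form, smul_add, ← LinearMap.map_smul (TW.form B (w i)), ← LinearMap.smul_apply,
      ← LinearMap.map_smul (TW.form B), hwD, hwD]
    simp only [map_add, map_sum, map_smul, LinearMap.add_apply, LinearMap.sum_apply,
      LinearMap.smul_apply, smul_eq_mul]
    have h3 : ∑ x, TW.form B (w i) (w x) * a j x = ∑ x, a j x * TW.form B (w i) (w x) :=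
      Finset.sum_congr rfl fun _ _ => mul_comm _ _
    rw [h3]
    linear_combination hK Y (w i) (w j)
  have hode2 := aux_det_ode M _ δ hode
  have hev : ∀ t, M.det.eval t = (Matrix.of fun i j => B (tEv L t (w i)) (tEv L t (w j))).det := by
    intro t
    rw [← coe_evalRingHom, RingHom.map_det]
    congr 1
    ext i j
    simp [hM, tEv_form]
  intro h0
  have hM0 : M.det = 0 := by
    refine aux_ode_zero δ _ M.det (by rw [hδ]; exact one_ne_zero) hode2 ?_
    rw [hev]
    simpa [hw, hΦ0, tEv_mk] using h0
  apply hdet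
  have := hev 1
  rw [hM0, eval_zero] at this
  simpa [hw, hΦ1, tEv_mk] using this.symm
end P1c

section P2

variable {F : Type*} [Field F] [IsAlgClosed F] [CharZero F]

lemma joint_basis {V : Type*} [AddCommGroup V] [Module F V] [FiniteDimensional F V]
    (A B : Module.End F V) (hA : A.IsSemisimple) (hB : B.IsSemisimple) (hAB : Commute A B) :
    ∃ (n : ℕ) (e : Basis (Fin n) F V) (a b : Fin n → F),
      (∀ i, A (e i) = a i • e i) ∧ (∀ i, B (e i) = b i • e i) := by
  classical
  set f : Bool → Module.End F V := fun t => if t then A else B with hf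
  have hc : ∀ i j, Commute (f i) (f j) := by
    intro i j
    cases i <;> cases j <;> simp [hf, hAB, hAB.symm]
  have hss : ∀ i, (f i).IsSemisimple := by
    intro i; cases i <;> simp [hf, hA, hB]
  have hind := Module.End.independent_iInf_maxGenEigenspace_of_forall_mapsTo f
    (fun i j φ => Module.End.mapsTo_maxGenEigenspace_of_comm (hc j i) φ)
  have htop := Module.End.iSup_iInf_maxGenEigenspace_eq_top_of_iSup_maxGenEigenspace_eq_top_of_commute
    f (fun i j _ => hc i j) (fun i => Module.End.iSup_maxGenEigenspace_eq_top _)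
  have hint := DirectSum.isInternal_submodule_of_iSupIndep_of_iSup_eq_top hind htop
  set e0 := hint.collectedBasis (fun χ => Module.finBasis F _) with he0
  have hmem : ∀ a (i : Bool), f i (e0 a) = a.1 i • e0 a := by
    intro a i
    have h1 := hint.collectedBasis_mem (fun χ => Module.finBasis F _) a
    rw [Submodule.mem_iInf] at h1
    have h2 := h1 i
    rw [(hss i).isFinitelySemisimple.maxGenEigenspace_eq_eigenspace] at h2
    exact Module.End.mem_eigenspace_iff.1 h2
  have : Finite _ := Module.Finite.finite_basis e0
  have := Fintype.ofFinite ((i : Bool → F) × Fin (finrank F ↥(⨅ i_1, (f i_1).maxGenEigenspace (i i_1))))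
  set ε := Fintype.equivFin ((i : Bool → F) × Fin (finrank F ↥(⨅ i_1, (f i_1).maxGenEigenspace (i i_1))))
  refine ⟨_, e0.reindex ε, fun i => (ε.symm i).1 true, fun i => (ε.symm i).1 false, ?_, ?_⟩
  · intro i
    simpa [hf] using hmem (ε.symm i) true
  · intro i
    simpa [hf] using hmem (ε.symm i) false

lemma diag_repr {V : Type*} [AddCommGroup V] [Module F V] {ι : Type*} [Fintype ι]
    (e : Basis ι F V) (A : Module.End F V) (a : ι → F) (hA : ∀ i, A (e i) = a i • e i)
    (v : V) (i : ι) : e.repr (A v) i = a i * e.repr v i := by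
  classical
  conv_lhs => rw [← e.sum_repr v]
  simp only [map_sum, map_smul, hA, Finsupp.coe_finsetSum, Finset.sum_apply, Finsupp.smul_apply,
    Basis.repr_self, smul_eq_mul, Finsupp.single_apply]
  simp [mul_comm]

variable {L : Type*} [LieRing L] [LieAlgebra F L] [FiniteDimensional F L] [LieAlgebra.IsKilling F L]

lemma exists_fun_elt (y : L) (f : F →+ F) :
    ∃ z : L, ∀ (μ : F) (v : L), v ∈ (ad F L y).maxGenEigenspace μ → ⁅z, v⁆ = f μ • v := by
  classical
  set V : F → Submodule F L := fun μ => (ad F L y).maxGenEigenspace μ with hV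
  have htop : ⨆ μ, V μ = ⊤ := Module.End.iSup_maxGenEigenspace_eq_top _
  have hint : DirectSum.IsInternal V :=
    DirectSum.isInternal_submodule_of_iSupIndep_of_iSup_eq_top
      (Module.End.independent_maxGenEigenspace _) htop
  set E := LinearEquiv.ofBijective (DirectSum.coeLinearMap V) hint with hE
  set D : L →ₗ[F] L := (DirectSum.toModule F F L (fun μ => f μ • (V μ).subtype)) ∘ₗ E.symm.toLinearMap
    with hD
  have hDv : ∀ μ v, v ∈ V μ → D v = f μ • v := by
    intro μ v hv
    have h1 : E (DirectSum.lof F F (fun μ => V μ) μ ⟨v, hv⟩) = v := by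
      exact DirectSum.coeLinearMap_lof V μ ⟨v, hv⟩
    have h2 : E.symm v = DirectSum.lof F F (fun μ => V μ) μ ⟨v, hv⟩ := by
      rw [LinearEquiv.symm_apply_eq, h1]
    simp [hD, h2]
  have hleib : ∀ a b, D ⁅a, b⁆ = ⁅D a, b⁆ + ⁅a, D b⁆ := by
    intro a b
    have ha : a ∈ ⨆ μ, V μ := htop ▸ Submodule.mem_top
    have hb : b ∈ ⨆ μ, V μ := htop ▸ Submodule.mem_top
    induction ha using Submodule.iSup_induction' with
    | zero => simp
    | add x y _ _ hx hy => simp only [add_lie, map_add, hx, hy]; abel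
    | mem μ x hx =>
      induction hb using Submodule.iSup_induction' with
      | zero => simp
      | add x y _ _ hx hy => simp only [lie_add, map_add, hx, hy]; abel
      | mem ν w hw =>
        have h3 : ⁅x, w⁆ ∈ V (μ + ν) := LieModule.lie_mem_maxGenEigenspace_toEnd hx hw
        rw [hDv _ _ h3, hDv _ _ hx, hDv _ _ hw, map_add, smul_lie, lie_smul, add_smul]
  obtain ⟨z, hz⟩ := LieDerivation.IsKilling.exists_eq_ad (R := F) (L := L)
    ({ toLinearMap := D, leibniz' := by
        intro a b
        rw [hleib, ← lie_skew b (D a)]; abel } : LieDerivation F L L)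
  refine ⟨z, fun μ v hv => ?_⟩
  have h4 := congrArg (fun d : LieDerivation F L L => d v) hz
  simp only [LieDerivation.ad_apply_apply] at h4
  rw [h4]
  exact hDv μ v hv

lemma elt_ext (F : Type*) [Field F] {L : Type*} [LieRing L] [LieAlgebra F L] [FiniteDimensional F L]
    [LieAlgebra.IsKilling F L] (z w : L) (h : ∀ v : L, ⁅z, v⁆ = ⁅w, v⁆) : z = w := by
  have h1 : z - w ∈ LieAlgebra.center F L := by
    rw [LieModule.mem_maxTrivSubmodule]
    intro x
    rw [← lie_skew, sub_lie, h x, sub_self, neg_zero]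
  rw [LieAlgebra.center_eq_bot] at h1
  exact sub_eq_zero.1 (by simpa using h1)

lemma elt_ext_gen (y z w : L)
    (h : ∀ (μ : F) (v : L), v ∈ (ad F L y).maxGenEigenspace μ → ⁅z, v⁆ = ⁅w, v⁆) : z = w := by
  refine elt_ext F z w fun v => ?_
  have hb : v ∈ ⨆ μ, (ad F L y).maxGenEigenspace μ :=
    (Module.End.iSup_maxGenEigenspace_eq_top (ad F L y)) ▸ Submodule.mem_top
  induction hb using Submodule.iSup_induction' with
  | zero => simp
  | add a b _ _ ha hb => rw [lie_add, lie_add, ha, hb]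
  | mem μ v hv => exact h μ v hv

lemma fun_elt_equiv (y z : L) (f : F →+ F)
    (hz : ∀ (μ : F) (v : L), v ∈ (ad F L y).maxGenEigenspace μ → ⁅z, v⁆ = f μ • v)
    (σ : L ≃ₗ⁅F⁆ L) (ε : F) (hε : ε = 1 ∨ ε = -1) (hσ : σ y = ε • y) : σ z = ε • z := by
  have hεε : ε * ε = 1 := by rcases hε with rfl | rfl <;> simp
  have hfε : ∀ μ, f (ε * μ) = ε * f μ := by rcases hε with rfl | rfl <;> simp
  refine elt_ext_gen (F := F) y _ _ fun μ v hv => ?_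
  have h1 : σ.symm v ∈ (ad F L y).maxGenEigenspace (ε * μ) := by
    rw [Module.End.mem_maxGenEigenspace] at hv ⊢
    obtain ⟨n, hn⟩ := hv
    refine ⟨n, ?_⟩
    have h2 : ∀ w, (ad F L y - (ε * μ) • (1 : Module.End F L)) (σ.symm w) =
        σ.symm (ε • (ad F L y - μ • (1 : Module.End F L)) w) := by
      intro w
      apply σ.injective
      change σ _ = σ _
      rw [LieEquiv.apply_symm_apply]
      simp only [LinearMap.sub_apply, ad_apply, LinearMap.smul_apply, Module.End.one_apply,
        lieEquiv_sub, lieEquiv_smul, LieEquiv.map_lie, LieEquiv.apply_symm_apply, hσ, smul_lie]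
      module
    have h3 : ∀ (m : ℕ) w, ((ad F L y - (ε * μ) • (1 : Module.End F L)) ^ m) (σ.symm w) =
        σ.symm (ε ^ m • ((ad F L y - μ • (1 : Module.End F L)) ^ m) w) := by
      intro m
      induction m with
      | zero => intro w; simp
      | succ m ih =>
        intro w
        rw [pow_succ, Module.End.mul_apply, h2, ih, pow_succ, pow_succ, Module.End.mul_apply,
          LinearMap.map_smul (((ad F L) y - μ • (1 : Module.End F L)) ^ m), smul_smul]
    rw [h3, hn, smul_zero]
    exact σ.symm.toLieHom.map_zero
  have h4 : ⁅σ z, v⁆ = σ ⁅z, σ.symm v⁆ := by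
    rw [LieEquiv.map_lie, LieEquiv.apply_symm_apply]
  rw [h4, hz _ _ h1, lieEquiv_smul, LieEquiv.apply_symm_apply, smul_lie, hz _ _ hv, hfε, smul_smul]

lemma fun_elt_comm (y z : L) (f : F →+ F)
    (hz : ∀ (μ : F) (v : L), v ∈ (ad F L y).maxGenEigenspace μ → ⁅z, v⁆ = f μ • v)
    (w : L) (hw : ⁅y, w⁆ = 0) : ⁅z, w⁆ = 0 := by
  rw [hz 0 w, map_zero, zero_smul]
  rw [Module.End.mem_maxGenEigenspace]
  exact ⟨1, by simp [hw]⟩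

lemma exists_jordan (y : L) : ∃ z : L,
    (ad F L z).IsSemisimple ∧ IsNilpotent (ad F L (y - z)) ∧
    (∀ w : L, ⁅y, w⁆ = 0 → ⁅z, w⁆ = 0) ∧
    (∀ (σ : L ≃ₗ⁅F⁆ L) (ε : F), (ε = 1 ∨ ε = -1) → σ y = ε • y → σ z = ε • z) := by
  obtain ⟨z, hz⟩ := exists_fun_elt (F := F) y (AddMonoidHom.id F)
  obtain ⟨n, hn, s, hs, hnil, hss, hsum⟩ := (ad F L y).exists_isNilpotent_isSemisimple
  have hcomm : Commute (ad F L y) s := Algebra.commute_of_mem_adjoin_self hs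
  have hzs : ad F L z = s := by
    have key : ∀ μ v, v ∈ (ad F L y).maxGenEigenspace μ → s v = μ • v := by
      intro μ v hv
      exact Module.End.apply_eq_of_mem_of_comm_of_isFinitelySemisimple_of_isNil hv hcomm
        hss.isFinitelySemisimple (by rw [hsum]; simpa using hnil)
    ext v
    have hb : v ∈ ⨆ μ, (ad F L y).maxGenEigenspace μ :=
      (Module.End.iSup_maxGenEigenspace_eq_top (ad F L y)) ▸ Submodule.mem_top
    induction hb using Submodule.iSup_induction' with
    | zero => simp
    | add a b _ _ ha hb => rw [map_add, map_add, ha, hb]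
    | mem μ v hv => rw [key μ v hv, ad_apply, hz μ v hv]; rfl
  refine ⟨z, hzs ▸ hss, ?_, fun_elt_comm y z _ hz, fun σ ε => fun_elt_equiv y z _ hz σ ε⟩
  rw [map_sub, hzs, hsum]
  simpa using hnil

end P2

section P3a

variable {F : Type*} [Field F] [IsAlgClosed F] [CharZero F]
variable {L : Type*} [LieRing L] [LieAlgebra F L] [FiniteDimensional F L] [LieAlgebra.IsKilling F L]

lemma ad_commute {F L : Type*} [Field F] [LieRing L] [LieAlgebra F L] {x y : L} (h : ⁅x, y⁆ = 0) :
    Commute (ad F L x) (ad F L y) := by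
  refine LinearMap.ext fun v => ?_
  change ⁅x, ⁅y, v⁆⁆ = ⁅y, ⁅x, v⁆⁆
  rw [leibniz_lie, h, zero_lie, zero_add]

lemma exists_generic (c : Submodule F L) (hss : ∀ x ∈ c, (ad F L x).IsSemisimple)
    (hcomm : ∀ x ∈ c, ∀ y ∈ c, ⁅x, y⁆ = 0) :
    ∃ s ∈ c, ∀ v : L, ⁅s, v⁆ = 0 → ∀ x ∈ c, ⁅x, v⁆ = 0 := by
  classical
  have hne : ∃ n, ∃ s ∈ c, finrank F (LinearMap.ker (ad F L s)) = n := ⟨_, 0, c.zero_mem, rfl⟩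
  obtain ⟨s, hs, hn⟩ := Nat.find_spec hne
  refine ⟨s, hs, fun v hv x hx => ?_⟩
  obtain ⟨n, e, a, b, ha, hb⟩ := joint_basis (ad F L s) (ad F L x) (hss s hs) (hss x hx)
    (ad_commute (hcomm s hs x hx))
  obtain ⟨t, ht⟩ := Infinite.exists_notMem_finset
    (insert 0 (Finset.univ.image fun i : Fin n => - a i / b i))
  simp only [Finset.mem_insert, Finset.mem_image, Finset.mem_univ, true_and, not_or, not_exists] at ht
  obtain ⟨ht0, ht1⟩ := ht
  have hmem : s + t • x ∈ c := c.add_mem hs (c.smul_mem t hx)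
  have hle : LinearMap.ker (ad F L (s + t • x)) ≤ LinearMap.ker (ad F L s) := by
    intro w hw
    rw [LinearMap.mem_ker] at hw ⊢
    apply e.repr.injective
    ext i
    rw [diag_repr e _ a ha, map_zero, Finsupp.zero_apply]
    have h1 : e.repr (ad F L (s + t • x) w) i = (a i + t * b i) * e.repr w i := by
      refine diag_repr e _ (fun i => a i + t * b i) (fun i => ?_) w i
      rw [map_add, map_smul, LinearMap.add_apply, LinearMap.smul_apply, ha, hb]
      module
    rw [hw, map_zero, Finsupp.zero_apply] at h1
    rcases mul_eq_zero.1 h1.symm with h2 | h2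
    · have h3 : b i = 0 := by
        by_contra hbi
        apply ht1 i
        field_simp
        linear_combination -h2
      rw [h3] at h2
      rw [show a i = 0 by linear_combination h2, zero_mul]
    · rw [h2, mul_zero]
  have hmin : finrank F (LinearMap.ker (ad F L s)) ≤ finrank F (LinearMap.ker (ad F L (s + t • x))) := by
    rw [hn]; exact Nat.find_min' hne ⟨_, hmem, rfl⟩
  have heq := Submodule.eq_of_le_of_finrank_le hle hmin
  have hv2 : v ∈ LinearMap.ker (ad F L (s + t • x)) := by
    rw [heq, LinearMap.mem_ker]; exact hv
  rw [LinearMap.mem_ker, ad_apply, add_lie, hv, zero_add, smul_lie] at hv2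
  exact (smul_eq_zero.1 hv2).resolve_left ht0

lemma kf_equiv (σ : L ≃ₗ⁅F⁆ L) (x y : L) : killingForm F L (σ x) (σ y) = killingForm F L x y :=
  LieAlgebra.killingForm_of_equiv_apply σ x y

lemma kf_lie (x y z : L) : killingForm F L ⁅x, y⁆ z = killingForm F L x ⁅y, z⁆ :=
  LieModule.traceForm_apply_lie_apply F L L x y z

lemma kf_comm (x y : L) : killingForm F L x y = killingForm F L y x :=
  LieModule.traceForm_comm F L L x y

lemma kf_zero (y : L) (h : ∀ v, killingForm F L y v = 0) : y = 0 := by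
  have h1 : y ∈ LinearMap.ker (killingForm F L) := by
    rw [LinearMap.mem_ker]; ext v; simpa using h v
  rw [LieAlgebra.IsKilling.ker_killingForm_eq_bot] at h1
  simpa using h1

lemma kf_nil (x y : L) (hx : IsNilpotent (ad F L x)) (h : ⁅x, y⁆ = 0) : killingForm F L x y = 0 := by
  rw [killingForm_apply_apply]
  have : IsNilpotent (ad F L x ∘ₗ ad F L y) := (ad_commute (F := F) h).isNilpotent_mul_right hx
  exact (LinearMap.isNilpotent_trace_of_isNilpotent this).eq_zero

/-- Two commuting involutions and a maximal toral subspace of the common `-1` space. -/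
structure QSetup (s1 s2 : L ≃ₗ⁅F⁆ L) (c : Submodule F L) : Prop where
  h1 : ∀ x, s1 (s1 x) = x
  h2 : ∀ x, s2 (s2 x) = x
  h12 : ∀ x, s1 (s2 x) = s2 (s1 x)
  hc1 : ∀ x ∈ c, s1 x = -x
  hc2 : ∀ x ∈ c, s2 x = -x
  hss : ∀ x ∈ c, (ad F L x).IsSemisimple
  hcomm : ∀ x ∈ c, ∀ y ∈ c, ⁅x, y⁆ = 0
  hmax : ∀ y, s1 y = -y → s2 y = -y → (ad F L y).IsSemisimple → (∀ x ∈ c, ⁅x, y⁆ = 0) → y ∈ c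

lemma cent_stable {c : Submodule F L} (σ : L ≃ₗ⁅F⁆ L) (hc : ∀ x ∈ c, σ x = -x) (v : L) (hv : ∀ x ∈ c, ⁅x, v⁆ = 0) :
    ∀ x ∈ c, ⁅x, σ v⁆ = 0 := by
  intro x hx
  have : ⁅σ x, σ v⁆ = 0 := by
    rw [← LieEquiv.map_lie, hv x hx]; exact σ.toLieHom.map_zero
  rw [hc x hx, neg_lie, neg_eq_zero] at this
  exact this

lemma kf_nondeg {s1 s2 : L ≃ₗ⁅F⁆ L} {c : Submodule F L} (H : QSetup s1 s2 c)
    (y : L) (hy1 : s1 y = -y) (hy2 : s2 y = -y) (hyc : ∀ x ∈ c, ⁅x, y⁆ = 0)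
    (hy : ∀ z, s1 z = -z → s2 z = -z → (∀ x ∈ c, ⁅x, z⁆ = 0) → killingForm F L y z = 0) : y = 0 := by
  obtain ⟨h1, h2, h12, hc1, hc2, hss, hcomm, hmax⟩ := H
  obtain ⟨s, hs, hgen⟩ := exists_generic c hss hcomm
  obtain ⟨n, e, a, -, ha, -⟩ := joint_basis (ad F L s) (ad F L s) (hss s hs) (hss s hs) rfl
  refine kf_zero (F := F) y fun v => ?_
  rw [← e.sum_repr v, map_sum]
  refine Finset.sum_eq_zero fun i _ => ?_
  rw [map_smul]
  suffices hsuff : killingForm F L y (e i) = 0 by rw [hsuff, smul_zero]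
  by_cases hai : a i = 0
  · have hv : ∀ x ∈ c, ⁅x, e i⁆ = 0 := by
      refine hgen _ ?_
      have := ha i
      rwa [hai, zero_smul] at this
    generalize e i = v at hv
    have hv1 := cent_stable s1 hc1 v hv
    have hv2 := cent_stable s2 hc2 v hv
    have hv12 := cent_stable s1 hc1 _ hv2
    have h3 := hy (v - s1 v - s2 v + s1 (s2 v))
      (by simp only [lieEquiv_add, lieEquiv_sub, h1]; abel)
      (by simp only [lieEquiv_add, lieEquiv_sub, h2, h12]; abel)
      (by intro x hx
          simp only [lie_add, lie_sub, hv x hx, hv1 x hx, hv2 x hx, hv12 x hx, sub_self, add_zero])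
    have k1 : ∀ w, killingForm F L y (s1 w) = - killingForm F L y w := by
      intro w
      have := kf_equiv s1 y w
      rw [hy1, map_neg, LinearMap.neg_apply] at this
      rw [← this, neg_neg]
    have k2 : ∀ w, killingForm F L y (s2 w) = - killingForm F L y w := by
      intro w
      have := kf_equiv s2 y w
      rw [hy2, map_neg, LinearMap.neg_apply] at this
      rw [← this, neg_neg]
    simp only [map_add, map_sub, k1, k2] at h3
    have h4 : (4 : F) * killingForm F L y v = 0 := by linear_combination h3
    exact (mul_eq_zero.1 h4).resolve_left (by norm_num)
  · have : e i = ⁅s, (a i)⁻¹ • e i⁆ := by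
      have := ha i
      rw [ad_apply] at this
      rw [lie_smul, this, smul_smul, inv_mul_cancel₀ hai, one_smul]
    rw [this, ← kf_lie, ← lie_skew, hyc s hs]
    simp

lemma cent_le {s1 s2 : L ≃ₗ⁅F⁆ L} {c : Submodule F L} (H : QSetup s1 s2 c)
    (y : L) (hy1 : s1 y = -y) (hy2 : s2 y = -y) (hyc : ∀ x ∈ c, ⁅x, y⁆ = 0) : y ∈ c := by
  have hmax := H.hmax
  have key : ∀ y : L, s1 y = -y → s2 y = -y → (∀ x ∈ c, ⁅x, y⁆ = 0) →
      ∃ t ∈ c, ∃ n : L, y = t + n ∧ IsNilpotent (ad F L n) ∧ s1 n = -n ∧ s2 n = -n ∧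
        (∀ x ∈ c, ⁅x, n⁆ = 0) := by
    intro y hy1 hy2 hyc
    obtain ⟨z, hz1, hz2, hz3, hz4⟩ := exists_jordan (F := F) y
    have hs1 : s1 z = -z := by
      simpa using hz4 s1 (-1) (Or.inr rfl) (by simpa using hy1)
    have hs2 : s2 z = -z := by
      simpa using hz4 s2 (-1) (Or.inr rfl) (by simpa using hy2)
    have hzc : ∀ x ∈ c, ⁅x, z⁆ = 0 := by
      intro x hx
      rw [← lie_skew, hz3 x (by rw [← lie_skew, hyc x hx, neg_zero]), neg_zero]
    refine ⟨z, hmax z hs1 hs2 hz1 hzc, y - z, by abel, hz2, ?_, ?_, ?_⟩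
    · rw [lieEquiv_sub, hs1, hy1]; abel
    · rw [lieEquiv_sub, hs2, hy2]; abel
    · intro x hx; rw [lie_sub, hyc x hx, hzc x hx, sub_zero]
  have nc : ∀ n t : L, IsNilpotent (ad F L n) → t ∈ c → (∀ x ∈ c, ⁅x, n⁆ = 0) →
      killingForm F L n t = 0 := by
    intro n t hn ht hnc
    exact kf_nil n t hn (by rw [← lie_skew, hnc t ht, neg_zero])
  have nn : ∀ n : L, IsNilpotent (ad F L n) → killingForm F L n n = 0 := by
    intro n hn
    exact kf_nil n n hn (lie_self n)
  obtain ⟨t, ht, n, hyn, hn, hn1, hn2, hnc⟩ := key y hy1 hy2 hyc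
  have hn0 : n = 0 := by
    refine kf_nondeg H n hn1 hn2 hnc ?_
    intro z hz1 hz2 hzc
    obtain ⟨t', ht', n', rfl, hn', hn1', hn2', hnc'⟩ := key z hz1 hz2 hzc
    rw [map_add, nc n t' hn ht' hnc, zero_add]
    obtain ⟨t'', ht'', n'', hsum, hn'', hn1'', hn2'', hnc''⟩ := key (n + n')
      (by rw [lieEquiv_add, hn1, hn1']; abel) (by rw [lieEquiv_add, hn2, hn2']; abel)
      (by intro x hx; rw [lie_add, hnc x hx, hnc' x hx, add_zero])
    have e1 : killingForm F L (n + n') (n + n') = killingForm F L (t'' + n'') (t'' + n'') := by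
      rw [hsum]
    have e2 : killingForm F L t'' t'' = 0 := by
      have : t'' = n + n' - n'' := by rw [hsum]; abel
      conv_lhs => enter [1]; rw [this]
      simp [nc n t'' hn ht'' hnc, nc n' t'' hn' ht'' hnc', nc n'' t'' hn'' ht'' hnc'']
    simp only [map_add, LinearMap.add_apply, nn n hn, nn n' hn', nn n'' hn'', e2,
      nc n'' t'' hn'' ht'' hnc'', kf_comm t'' n'', kf_comm n' n] at e1
    have e3 : (2 : F) * killingForm F L n n' = 0 := by linear_combination e1
    exact (mul_eq_zero.1 e3).resolve_left (by norm_num)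
  rw [hyn, hn0, add_zero]
  exact ht

end P3a

section P3b

variable {F : Type*} [Field F] [IsAlgClosed F] [CharZero F]
variable {L : Type*} [LieRing L] [LieAlgebra F L] [FiniteDimensional F L] [LieAlgebra.IsKilling F L]

lemma lie_zero_symm {x y : L} (h : ⁅x, y⁆ = 0) : ⁅y, x⁆ = 0 := by
  rw [← lie_skew, h, neg_zero]

lemma fix_comm {s1 s2 : L ≃ₗ⁅F⁆ L} {c : Submodule F L} (H : QSetup s1 s2 c)
    (u : L) (hu1 : s1 u = -u) (hu2 : s2 u = u) (huc : ∀ x ∈ c, ⁅x, u⁆ = 0)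
    (w : L) (hwc : ∀ x ∈ c, ⁅x, w⁆ = 0) (hw2 : s2 w = -w) : ⁅u, w⁆ = 0 := by
  have hs1w := cent_stable s1 H.hc1 w hwc
  have hA : w - s1 w ∈ c := by
    refine cent_le H _ ?_ ?_ ?_
    · rw [lieEquiv_sub, H.h1]; abel
    · rw [lieEquiv_sub, ← H.h12, hw2, lieEquiv_neg]; abel
    · intro x hx; rw [lie_sub, hwc x hx, hs1w x hx, sub_zero]
  have hB : ⁅u, w + s1 w⁆ = 0 := by
    refine kf_nondeg H _ ?_ ?_ ?_ ?_
    · rw [LieEquiv.map_lie, hu1, lieEquiv_add, H.h1, neg_lie, add_comm]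
    · rw [LieEquiv.map_lie, hu2, lieEquiv_add, ← H.h12, hw2, lieEquiv_neg, ← lie_neg]
      congr 1; abel
    · intro x hx
      rw [leibniz_lie, huc x hx, lie_add x, hwc x hx, hs1w x hx]
      simp
    · intro z hz1 hz2 hzc
      rw [← lie_skew, map_neg, LinearMap.neg_apply, kf_lie,
        lie_zero_symm (huc z (cent_le H z hz1 hz2 hzc))]
      simp
  have hA2 : ⁅u, w - s1 w⁆ = 0 := lie_zero_symm (huc _ hA)
  have h3 : (2 : F) • ⁅u, w⁆ = 0 := by
    have : (2 : F) • ⁅u, w⁆ = ⁅u, w + s1 w⁆ + ⁅u, w - s1 w⁆ := by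
      rw [lie_add, lie_sub, two_smul]; abel
    rw [this, hA2, hB, add_zero]
  exact (smul_eq_zero.1 h3).resolve_left (by norm_num)

lemma exists_rat_fun {n : ℕ} (a : Fin n → F) :
    ∃ (f : F →+ F) (q : Fin n → ℚ), (∀ i, f (a i) = (q i : F)) ∧ ∀ i, q i = 0 ↔ a i = 0 := by
  obtain ⟨f, hf⟩ := Module.exists_dual_forall_apply_ne_zero (K := ℚ) (M := F)
    (fun i : {i : Fin n // a i ≠ 0} => a i) (fun i => i.2)
  refine ⟨(algebraMap ℚ F).toAddMonoidHom.comp f.toAddMonoidHom, fun i => f (a i), fun i => ?_,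
    fun i => ⟨fun h => ?_, fun h => ?_⟩⟩
  · simp
  · by_contra h0
    exact hf ⟨i, h0⟩ h
  · simp only [h, map_zero]

lemma exists_big {n : ℕ} (q b : Fin n → ℚ) : ∃ N : ℚ, N ≠ 0 ∧ ∀ i, q i ≠ 0 → |b i| < |N * q i| := by
  obtain ⟨M, hM⟩ := Finite.exists_le (fun i => |b i| / |q i|)
  have hp : 0 < |M| + 1 := by positivity
  refine ⟨|M| + 1, hp.ne', fun i hi => ?_⟩
  have hq : 0 < |q i| := abs_pos.2 hi
  rw [abs_mul, abs_of_pos hp]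
  have h1 := hM i
  rw [div_le_iff₀ hq] at h1
  have h2 : M ≤ |M| := le_abs_self M
  nlinarith

/-- Weight data. -/
structure WtData (s1 s2 : L ≃ₗ⁅F⁆ L) (c : Submodule F L) {n : ℕ} (e : Basis (Fin n) F L)
    (a b : Fin n → ℚ) (h u : L) : Prop where
  hh : ∀ i, ⁅h, e i⁆ = (a i : F) • e i
  hu : ∀ i, ⁅u, e i⁆ = (b i : F) • e i
  hab : ∀ i, a i ≠ 0 → |b i| < |a i|
  h1 : s1 h = -h
  h2 : s2 h = -h
  u1 : s1 u = -u
  u2 : s2 u = u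
  h0 : ∀ i, a i = 0 → ∀ x ∈ c, ⁅x, e i⁆ = 0
  uc : ∀ x ∈ c, ⁅x, u⁆ = 0

lemma exists_data {s1 s2 : L ≃ₗ⁅F⁆ L} {c : Submodule F L} (H : QSetup s1 s2 c)
    (u0 : L) (hu1 : s1 u0 = -u0) (hu2 : s2 u0 = u0) (huc : ∀ x ∈ c, ⁅x, u0⁆ = 0)
    (huss : (ad F L u0).IsSemisimple) :
    ∃ (n : ℕ) (e : Basis (Fin n) F L) (a b : Fin n → ℚ) (h u : L),
      WtData s1 s2 c e a b h u ∧ ((∀ i, b i = 0) → u0 = 0) := by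
  obtain ⟨s, hs, hgen⟩ := exists_generic c H.hss H.hcomm
  obtain ⟨n, e, a, b, ha, hb⟩ := joint_basis (ad F L s) (ad F L u0) (H.hss s hs) huss
    (ad_commute (huc s hs))
  obtain ⟨f, q, hf, hq⟩ := exists_rat_fun a
  obtain ⟨f', r, hf', hr⟩ := exists_rat_fun b
  obtain ⟨N, hN, hNr⟩ := exists_big q r
  obtain ⟨h, hh⟩ := exists_fun_elt (F := F) s f
  obtain ⟨u, hu⟩ := exists_fun_elt (F := F) u0 f'
  have mem : ∀ (y : L) (μ : F) (v : L), ⁅y, v⁆ = μ • v → v ∈ (ad F L y).maxGenEigenspace μ := by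
    intro y μ v hv
    rw [Module.End.mem_maxGenEigenspace]
    exact ⟨1, by simp [hv]⟩
  refine ⟨n, e, fun i => N * q i, r, (N : F) • h, u, ⟨?_, ?_, ?_, ?_, ?_, ?_, ?_, ?_, ?_⟩, ?_⟩
  · intro i
    rw [smul_lie, hh (a i) (e i) (mem _ _ _ (ha i)), hf, smul_smul, Rat.cast_mul]
  · intro i
    rw [hu (b i) (e i) (mem _ _ _ (hb i)), hf']
  · intro i hi
    exact hNr i (right_ne_zero_of_mul hi)
  · have := fun_elt_equiv s h f hh s1 (-1) (Or.inr rfl) (by simpa using H.hc1 s hs)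
    rw [lieEquiv_smul, this]; simp
  · have := fun_elt_equiv s h f hh s2 (-1) (Or.inr rfl) (by simpa using H.hc2 s hs)
    rw [lieEquiv_smul, this]; simp
  · simpa using fun_elt_equiv u0 u f' hu s1 (-1) (Or.inr rfl) (by simpa using hu1)
  · simpa using fun_elt_equiv u0 u f' hu s2 1 (Or.inl rfl) (by simpa using hu2)
  · intro i hi
    have h3 : a i = 0 := (hq i).1 ((mul_eq_zero.1 hi).resolve_left hN)
    refine hgen _ ?_
    have := ha i
    rwa [h3, zero_smul] at this
  · intro x hx
    exact lie_zero_symm (fun_elt_comm u0 u f' hu x (lie_zero_symm (huc x hx)))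
  · intro h0
    refine elt_ext F _ _ fun v => ?_
    have : ad F L u0 = 0 := by
      refine e.ext fun i => ?_
      rw [hb, (hr i).1 (h0 i)]; simp
    rw [← ad_apply F, this]; simp

lemma kf_wt (x v w : L) (α β : F) (hv : ⁅x, v⁆ = α • v) (hw : ⁅x, w⁆ = β • w) :
    (α + β) * killingForm F L v w = 0 := by
  have h := kf_lie (F := F) v x w
  rw [← lie_skew, hv, hw] at h
  simp only [map_neg, map_smul, LinearMap.neg_apply, LinearMap.smul_apply, smul_eq_mul] at h
  linear_combination -h

lemma wt_mem {n : ℕ} (e : Basis (Fin n) F L) (ξ : Fin n → ℚ) (y : L)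
    (hy : ∀ i, ⁅y, e i⁆ = (ξ i : F) • e i) (S : Set ℚ) (t : ℚ) (ht : t ∈ S) (v : L)
    (hv : ⁅y, v⁆ = (t : F) • v) :
    v ∈ Submodule.span F (Set.range fun i : {i // ξ i ∈ S} => e i) := by
  rw [← e.sum_repr v]
  refine Submodule.sum_mem _ fun i _ => ?_
  have h1 := diag_repr e (ad F L y) (fun i => (ξ i : F)) hy v i
  rw [ad_apply, hv, map_smul, Finsupp.smul_apply, smul_eq_mul] at h1
  by_cases h0 : e.repr v i = 0
  · rw [h0, zero_smul]; exact Submodule.zero_mem _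
  · have h2 : t = ξ i := by exact_mod_cast mul_right_cancel₀ h0 h1
    exact Submodule.smul_mem _ _ (Submodule.subset_span ⟨⟨i, h2 ▸ ht⟩, rfl⟩)

lemma gram_det {n : ℕ} (e : Basis (Fin n) F L) (ξ : Fin n → ℚ) (y : L)
    (hy : ∀ i, ⁅y, e i⁆ = (ξ i : F) • e i) (s1 : L ≃ₗ⁅F⁆ L) (h1 : ∀ x, s1 (s1 x) = x)
    (hs : s1 y = -y) (S : Set ℚ) [DecidablePred (· ∈ S)] :
    (Matrix.of fun i j : {i // ξ i ∈ S} => killingForm F L (e i) (s1 (e j))).det ≠ 0 := by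
  intro hdet
  obtain ⟨v, hv0, hv⟩ := Matrix.exists_vecMul_eq_zero_iff.2 hdet
  apply hv0
  have hV : ∑ i, v i • e (i : Fin n) = 0 := by
    refine kf_zero (F := F) _ fun w => ?_
    rw [← h1 w]
    generalize s1 w = w
    rw [← e.sum_repr w]
    have key : ∀ j, killingForm F L (∑ i, v i • e (i : Fin n)) (s1 (e j)) = 0 := by
      intro j
      by_cases hj : ξ j ∈ S
      · have := congrFun hv ⟨j, hj⟩
        simpa [Matrix.vecMul, dotProduct] using this
      · rw [map_sum, LinearMap.sum_apply]
        refine Finset.sum_eq_zero fun i _ => ?_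
        rw [map_smul, LinearMap.smul_apply]
        have hw : ⁅y, s1 (e j)⁆ = (-(ξ j : F)) • s1 (e j) := by
          have : s1 ⁅y, e j⁆ = s1 ((ξ j : F) • e j) := by rw [hy]
          rw [LieEquiv.map_lie, hs, lieEquiv_smul, neg_lie] at this
          rw [neg_smul, ← this, neg_neg]
        have h3 := kf_wt y _ _ _ _ (hy i) hw
        rcases mul_eq_zero.1 h3 with h4 | h4
        · exfalso
          apply hj
          have : ξ i = ξ j := by
            have : (ξ i : F) = ξ j := by linear_combination h4
            exact_mod_cast this
          exact this ▸ i.2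
        · rw [h4, smul_zero]
    have h5 : killingForm F L (∑ i, v i • e (i : Fin n)) ∘ₗ (s1.toLinearEquiv : L →ₗ[F] L) = 0 :=
      e.ext fun j => by simpa using key j
    exact LinearMap.congr_fun h5 _
  have hli : LinearIndependent F (fun i : {i // ξ i ∈ S} => e (i : Fin n)) :=
    e.linearIndependent.comp _ Subtype.val_injective
  exact funext (Fintype.linearIndependent_iff.1 hli v hV)

lemma trace_zero {ι : Type*} [Fintype ι] [DecidableEq ι] (M : Matrix ι ι F) (b : ι → F)
    (hM : M.det ≠ 0) (h : ∀ i j, (b i + b j) * M i j = 0) : ∑ i, b i = 0 := by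
  have hu : IsUnit M.det := isUnit_iff_ne_zero.2 hM
  have h1 : Matrix.diagonal b * M = -(M * Matrix.diagonal b) := by
    ext i j
    rw [Matrix.diagonal_mul, Matrix.neg_apply, Matrix.mul_diagonal]
    linear_combination h i j
  have h2 : Matrix.trace (Matrix.diagonal b) = -Matrix.trace (Matrix.diagonal b) := by
    have e1 : Matrix.diagonal b = -(M * Matrix.diagonal b * M⁻¹) := by
      rw [← neg_mul, ← h1, Matrix.mul_nonsing_inv_cancel_right _ _ hu]
    conv_lhs => rw [e1]
    rw [Matrix.trace_neg, Matrix.trace_mul_comm, ← mul_assoc, Matrix.nonsing_inv_mul _ hu, one_mul]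
  rw [Matrix.trace_diagonal] at h2
  have h3 : (2 : F) * ∑ i, b i = 0 := by linear_combination h2
  exact (mul_eq_zero.1 h3).resolve_left (by norm_num)

lemma span_top {s1 s2 : L ≃ₗ⁅F⁆ L} {c : Submodule F L} (H : QSetup s1 s2 c) {n : ℕ}
    {e : Basis (Fin n) F L} {a b : Fin n → ℚ} {h u : L} (D : WtData s1 s2 c e a b h u)
    (K : Submodule F L) (hK : ∀ x, x ∈ K ↔ s2 x = x) :
    K ⊔ Submodule.span F (Set.range fun i : {i // a i + b i ∈ Set.Ici (0 : ℚ)} => e i) = ⊤ := by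
  rw [eq_top_iff, ← e.span_eq, Submodule.span_le]
  rintro _ ⟨i, rfl⟩
  by_cases hpos : a i + b i ∈ Set.Ici (0 : ℚ)
  · exact Submodule.mem_sup_right (Submodule.subset_span ⟨⟨i, hpos⟩, rfl⟩)
  simp only [Set.mem_Ici, not_le] at hpos
  by_cases hai : a i = 0
  · have hec := D.h0 i hai
    have hs2 := cent_stable s2 H.hc2 (e i) hec
    have hz : ⁅u, e i - s2 (e i)⁆ = 0 := by
      refine fix_comm H u D.u1 D.u2 D.uc _ ?_ ?_
      · intro x hx; rw [lie_sub, hec x hx, hs2 x hx, sub_zero]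
      · rw [lieEquiv_sub, H.h2]; abel
    have hus : ⁅u, s2 (e i)⁆ = (b i : F) • s2 (e i) := by
      have : s2 ⁅u, e i⁆ = s2 ((b i : F) • e i) := by rw [D.hu]
      rwa [LieEquiv.map_lie, D.u2, lieEquiv_smul] at this
    rw [lie_sub, D.hu, hus, ← smul_sub] at hz
    have hb : (b i : F) ≠ 0 := by
      have : b i ≠ 0 := by
        rw [hai, zero_add] at hpos; exact hpos.ne
      exact_mod_cast this
    have := (smul_eq_zero.1 hz).resolve_left hb
    exact Submodule.mem_sup_left ((hK _).2 (sub_eq_zero.1 this).symm)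
  · have hlt := D.hab i hai
    have hneg : 0 ≤ -a i + b i := by
      rcases lt_or_gt_of_ne hai with h3 | h3
      · rw [abs_of_neg h3] at hlt
        have := neg_abs_le (b i)
        linarith
      · rw [abs_of_pos h3] at hlt
        have := neg_abs_le (b i)
        linarith
    have hw : ⁅h + u, s2 (e i)⁆ = ((-a i + b i : ℚ) : F) • s2 (e i) := by
      have e1 : s2 ⁅u, e i⁆ = s2 ((b i : F) • e i) := by rw [D.hu]
      have e2 : s2 ⁅h, e i⁆ = s2 ((a i : F) • e i) := by rw [D.hh]
      rw [LieEquiv.map_lie, D.u2, lieEquiv_smul] at e1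
      rw [LieEquiv.map_lie, D.h2, lieEquiv_smul, neg_lie] at e2
      rw [add_lie, e1, ← neg_neg ⁅h, s2 (e i)⁆, e2]
      push_cast
      module
    have hP := wt_mem e (fun i => a i + b i) (h + u)
      (fun i => by rw [add_lie, D.hh, D.hu]; push_cast; module) (Set.Ici 0) _ hneg _ hw
    have hKm : e i + s2 (e i) ∈ K := by
      rw [hK, lieEquiv_add, H.h2, add_comm]
    have : e i = (e i + s2 (e i)) - s2 (e i) := by abel
    rw [this]
    exact Submodule.sub_mem _ (Submodule.mem_sup_left hKm) (Submodule.mem_sup_right hP)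

lemma sum_upper {s1 s2 : L ≃ₗ⁅F⁆ L} {c : Submodule F L} (H : QSetup s1 s2 c) {n : ℕ}
    {e : Basis (Fin n) F L} {a b : Fin n → ℚ} {h u : L} (D : WtData s1 s2 c e a b h u)
    (φ : L ≃ₗ⁅F⁆ L) (hφ : IsCurve φ.toLinearEquiv) (hconj : ∀ x, s2 (φ x) = φ (s1 x))
    (S : Set ℚ) [DecidablePred (· ∈ S)] (hS : ∀ t ∈ S, ∀ r : ℚ, 0 ≤ r → r + t ∈ S) :
    ∑ i with a i + b i ∈ S, b i = 0 := by
  set B : LinearMap.BilinForm F L :=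
    (killingForm F L).compl₂ (s2.toLinearEquiv : L →ₗ[F] L) with hBdef
  have hBa : ∀ v w, B v w = killingForm F L v (s2 w) := fun v w => rfl
  set K : Submodule F L := LinearMap.ker ((s2.toLinearEquiv : L →ₗ[F] L) - LinearMap.id) with hKdef
  have hK : ∀ x, x ∈ K ↔ s2 x = x := by
    intro x
    rw [hKdef, LinearMap.mem_ker, LinearMap.sub_apply, sub_eq_zero]; rfl
  have hy : ∀ i, ⁅h + u, e i⁆ = ((a i + b i : ℚ) : F) • e i :=
    fun i => by rw [add_lie, D.hh, D.hu]; push_cast; module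
  have hBK : ∀ x ∈ K, ∀ v w, B ⁅x, v⁆ w + B v ⁅x, w⁆ = 0 := by
    intro x hx v w
    rw [hBa, hBa, LieEquiv.map_lie, (hK x).1 hx, ← lie_skew, map_neg, LinearMap.neg_apply, kf_lie]
    ring
  have hdet := core_lemma B K _ (span_top H D K hK) hBK
    (fun i : {i // a i + b i ∈ S} => e i) (by
      intro x hx i
      induction hx using Submodule.span_induction with
      | mem x hx =>
        obtain ⟨j, rfl⟩ := hx
        refine wt_mem e (fun i => a i + b i) (h + u) hy S _ (hS _ i.2 _ j.2) _ ?_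
        rw [leibniz_lie, hy, hy, smul_lie, lie_smul]
        push_cast
        module
      | zero => simp
      | add x y _ _ hx hy => rw [add_lie]; exact Submodule.add_mem _ hx hy
      | smul t x _ hx => rw [smul_lie]; exact Submodule.smul_mem _ _ hx)
    φ.toLinearEquiv hφ (by
      have h0 := gram_det e (fun i => a i + b i) (h + u) hy s1 H.h1
        (by rw [lieEquiv_add, D.h1, D.u1]; abel) S
      convert h0 using 4 with i
      ext j
      rw [hBa]
      change killingForm F L (φ (e i)) (s2 (φ (e j))) = _
      rw [hconj, kf_equiv])
  have h3 := trace_zero _ (fun i : {i // a i + b i ∈ S} => (b i : F)) hdet (by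
    intro i j
    rw [Matrix.of_apply, hBa]
    refine kf_wt u _ _ _ _ (D.hu i) ?_
    have : s2 ⁅u, e j⁆ = s2 ((b j : F) • e j) := by rw [D.hu]
    rwa [LieEquiv.map_lie, D.u2, lieEquiv_smul] at this)
  rw [← Finset.sum_subtype_eq_sum_filter]
  have h4 : ∑ i : {i // a i + b i ∈ S}, b i = 0 := by exact_mod_cast h3
  simpa using h4

lemma b_zero {s1 s2 : L ≃ₗ⁅F⁆ L} {c : Submodule F L} (H : QSetup s1 s2 c) {n : ℕ}
    {e : Basis (Fin n) F L} {a b : Fin n → ℚ} {h u : L} (D : WtData s1 s2 c e a b h u)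
    (φ : L ≃ₗ⁅F⁆ L) (hφ : IsCurve φ.toLinearEquiv) (hconj : ∀ x, s2 (φ x) = φ (s1 x)) :
    ∀ i, b i = 0 := by
  classical
  have hj : ∀ j : ℚ, ∑ i with a i + b i = j, b i = 0 := by
    intro j
    have k1 := sum_upper H D φ hφ hconj (Set.Ici j)
      (fun t ht r hr => by simp only [Set.mem_Ici] at *; linarith)
    have k2 := sum_upper H D φ hφ hconj (Set.Ioi j)
      (fun t ht r hr => by simp only [Set.mem_Ioi] at *; linarith)
    rw [Finset.sum_filter] at k1 k2 ⊢
    have k3 : (∑ i, if a i + b i = j then b i else 0) =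
        (∑ i, if a i + b i ∈ Set.Ici j then b i else 0) -
          ∑ i, if a i + b i ∈ Set.Ioi j then b i else 0 := by
      rw [← Finset.sum_sub_distrib]
      refine Finset.sum_congr rfl fun i _ => ?_
      simp only [Set.mem_Ici, Set.mem_Ioi]
      rcases lt_trichotomy (a i + b i) j with h3 | h3 | h3
      · rw [if_neg h3.ne, if_neg h3.not_ge, if_neg h3.not_gt, sub_zero]
      · rw [if_pos h3, if_pos h3.ge, if_neg h3.not_gt, sub_zero]
      · rw [if_neg h3.ne', if_pos h3.le, if_pos h3, sub_self]
    rw [k3, k1, k2, sub_zero]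
  have hsum : ∑ i, (a i + b i) * b i = 0 := by
    rw [← Finset.sum_fiberwise_of_maps_to (s := Finset.univ)
      (t := Finset.univ.image fun i => a i + b i) (g := fun i => a i + b i)
      (f := fun i => (a i + b i) * b i)
      (fun i _ => Finset.mem_image_of_mem _ (Finset.mem_univ i))]
    refine Finset.sum_eq_zero fun j _ => ?_
    rw [← mul_zero j, ← hj j, Finset.mul_sum]
    refine Finset.sum_congr rfl fun i hi => ?_
    rw [(Finset.mem_filter.1 hi).2]
  have hk : killingForm F L h u = 0 := by
    have := kf_equiv s2 h u
    rw [D.h2, D.u2, map_neg, LinearMap.neg_apply] at this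
    have h2 : (2 : F) * killingForm F L h u = 0 := by linear_combination -this
    exact (mul_eq_zero.1 h2).resolve_left (by norm_num)
  have hab : ∑ i, a i * b i = 0 := by
    rw [killingForm_apply_apply, LinearMap.trace_eq_matrix_trace F e, Matrix.trace] at hk
    have : ∀ i, (LinearMap.toMatrix e e (ad F L h ∘ₗ ad F L u)).diag i = ((a i * b i : ℚ) : F) := by
      intro i
      rw [Matrix.diag_apply, LinearMap.toMatrix_apply, LinearMap.comp_apply, ad_apply, ad_apply,
        D.hu, lie_smul, D.hh]
      simp [mul_comm]
    simp only [this] at hk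
    exact_mod_cast hk
  have hbb : ∑ i, b i * b i = 0 := by
    have : ∑ i, (a i + b i) * b i = ∑ i, a i * b i + ∑ i, b i * b i := by
      rw [← Finset.sum_add_distrib]
      exact Finset.sum_congr rfl fun i _ => by ring
    linarith
  intro i
  have := (Finset.sum_eq_zero_iff_of_nonneg (fun i _ => mul_self_nonneg (b i))).1 hbb i
    (Finset.mem_univ i)
  exact mul_self_eq_zero.1 this

lemma stepB {s1 s2 : L ≃ₗ⁅F⁆ L} {c : Submodule F L} (H : QSetup s1 s2 c)
    (φ : L ≃ₗ⁅F⁆ L) (hφ : IsCurve φ.toLinearEquiv) (hconj : ∀ x, s2 (φ x) = φ (s1 x))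
    (u0 : L) (hu1 : s1 u0 = -u0) (hu2 : s2 u0 = u0) (huc : ∀ x ∈ c, ⁅x, u0⁆ = 0)
    (huss : (ad F L u0).IsSemisimple) : u0 = 0 := by
  obtain ⟨n, e, a, b, h, u, D, h0⟩ := exists_data H u0 hu1 hu2 huc huss
  exact h0 (b_zero H D φ hφ hconj)

end P3b

lemma isCurve_of_isInnerAut (μ : g ≃ₗ⁅k⁆ g) (h : IsInnerAut k g μ) : IsCurve μ.toLinearEquiv := by
  unfold IsInnerAut at h
  generalize μ.toLinearEquiv = e at h ⊢
  induction h using Subgroup.closure_induction with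
  | mem e he =>
    obtain ⟨x, hx, he⟩ := he
    refine IsCurve.exp x (finrank k g) ?_ he
    have h1 := LinearMap.aeval_self_charpoly (ad k g x)
    rwa [IsNilpotent.charpoly_eq_X_pow_finrank hx, map_pow, Polynomial.aeval_X] at h1
  | one => exact IsCurve.one
  | mul _ _ _ _ h1 h2 => exact h1.mul h2
  | inv _ _ h1 => exact h1.inv

lemma innerConj_symm {σ τ : g ≃ₗ⁅k⁆ g} (h : InnerConj k g σ τ) : InnerConj k g τ σ := by
  obtain ⟨φ, hφ, h⟩ := h
  refine ⟨φ.symm, ?_, fun x => ?_⟩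
  · exact inv_mem hφ
  · rw [h, LieEquiv.symm_symm, LieEquiv.symm_apply_apply, LieEquiv.symm_apply_apply]

lemma mem_qSpace {σ₁ σ₂ : g ≃ₗ⁅k⁆ g} {i j : Bool} {x : g} :
    x ∈ qSpace k g σ₁ σ₂ i j ↔
      σ₁ x = (if i then -1 else 1 : k) • x ∧ σ₂ x = (if j then -1 else 1 : k) • x := by
  unfold qSpace eigSub
  rw [Submodule.mem_inf, Module.End.mem_eigenspace_iff, Module.End.mem_eigenspace_iff]
  rfl

lemma dyad_main (s1 s2 : g ≃ₗ⁅k⁆ g) (h1 : IsInvolution k g s1) (h2 : IsInvolution k g s2)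
    (h12 : ∀ x, s1 (s2 x) = s2 (s1 x)) (hconj : InnerConj k g s1 s2) (m m' : Submodule k g)
    (hm : ∀ x, x ∈ m ↔ s1 x = -x ∧ s2 x = -x) (hm' : ∀ x, x ∈ m' ↔ s1 x = -x ∧ s2 x = x)
    (c : Submodule k g) (hc : IsCartanSubspace k g m c) : IsCartanSubspace k g (m ⊔ m') c := by
  obtain ⟨hcm, hss, hcomm, hmax⟩ := hc
  have H : QSetup s1 s2 c := by
    refine ⟨h1, h2, h12, fun x hx => ((hm x).1 (hcm hx)).1, fun x hx => ((hm x).1 (hcm hx)).2,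
      hss, hcomm, fun y hy1 hy2 hys hyc => ?_⟩
    have hle : c ⊔ Submodule.span k {y} = c := by
      refine hmax _ (sup_le hcm ?_) ?_ ?_ le_sup_left
      · rw [Submodule.span_le, Set.singleton_subset_iff]
        exact (hm y).2 ⟨hy1, hy2⟩
      · intro x hx
        obtain ⟨z, hz, w, hw, rfl⟩ := Submodule.mem_sup.1 hx
        obtain ⟨t, rfl⟩ := Submodule.mem_span_singleton.1 hw
        unfold IsSSElt
        rw [map_add]
        refine Module.End.IsSemisimple.add_of_commute (ad_commute ?_) (hss z hz) ?_
        · rw [lie_smul, hyc z hz, smul_zero]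
        · rw [map_smul]
          exact Module.End.IsSemisimple_smul t hys
      · intro x hx x' hx'
        obtain ⟨z, hz, w, hw, rfl⟩ := Submodule.mem_sup.1 hx
        obtain ⟨t, rfl⟩ := Submodule.mem_span_singleton.1 hw
        obtain ⟨z', hz', w', hw', rfl⟩ := Submodule.mem_sup.1 hx'
        obtain ⟨t', rfl⟩ := Submodule.mem_span_singleton.1 hw'
        have e1 : ⁅y, z'⁆ = 0 := by rw [← lie_skew, hyc z' hz', neg_zero]
        simp [hcomm z hz z' hz', hyc z hz, e1]
    rw [← hle]
    exact Submodule.mem_sup_right (Submodule.mem_span_singleton_self y)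
  refine ⟨hcm.trans le_sup_left, hss, hcomm, fun c' hc' hss' hcomm' hcc => ?_⟩
  refine le_antisymm (fun x hx => ?_) hcc
  obtain ⟨y, hy, z, hz, rfl⟩ := Submodule.mem_sup.1 (hc' hx)
  obtain ⟨hy1, hy2⟩ := (hm y).1 hy
  obtain ⟨hz1, hz2⟩ := (hm' z).1 hz
  have hxc : ∀ w ∈ c, ⁅w, y + z⁆ = 0 := fun w hw => hcomm' w (hcc hw) _ hx
  have hxs := cent_stable s2 H.hc2 _ hxc
  have hyc : ∀ w ∈ c, ⁅w, y⁆ = 0 := by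
    intro w hw
    have e1 := hxc w hw
    have e2 := hxs w hw
    rw [lieEquiv_add, hy2, hz2, lie_add, lie_neg] at e2
    rw [lie_add] at e1
    have e3 : (2 : k) • ⁅w, y⁆ = 0 := by
      rw [two_smul]
      calc ⁅w, y⁆ + ⁅w, y⁆ = (⁅w, y⁆ + ⁅w, z⁆) - (-⁅w, y⁆ + ⁅w, z⁆) := by abel
        _ = 0 := by rw [e1, e2, sub_zero]
    exact (smul_eq_zero.1 e3).resolve_left (by norm_num)
  have hyC : y ∈ c := cent_le H y hy1 hy2 hyc
  have hzC : ∀ w ∈ c, ⁅w, z⁆ = 0 := by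
    intro w hw
    have e1 := hxc w hw
    rwa [lie_add, hyc w hw, zero_add] at e1
  have hz' : z ∈ c' := by
    have := c'.sub_mem hx (hcc hyC)
    rwa [add_sub_cancel_left] at this
  obtain ⟨φ, hφ, hcj⟩ := hconj
  have : z = 0 := stepB H φ (isCurve_of_isInnerAut k g φ hφ)
    (fun x => by rw [hcj, LieEquiv.symm_apply_apply]) z hz1 hz2 hzC (hss' z hz')
  rw [this, add_zero]
  exact hyC

/-- If `{σ₁, σ₂, σ₃}` is a triad (with `σ₃ = σ₁σ₂` and the three
involutions pairwise conjugate by inner automorphisms), then for every permutation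
`(α, β, γ)` of the indices `(01, 10, 11)` (encoded by pairs of booleans), any Cartan
subspace of `g_α` is also a Cartan subspace of `g_α ⊕ g_β` and of `g_α ⊕ g_γ`. -/
theorem cartanSubspace_coincidences_of_triad (σ₁ σ₂ : g ≃ₗ⁅k⁆ g)
    (h12 : IsDyad k g σ₁ σ₂)
    (h13 : InnerConj k g σ₁ (σ₂.trans σ₁))
    (h23 : InnerConj k g σ₂ (σ₂.trans σ₁)) :
    ∀ a b : Bool × Bool, a ≠ (false, false) → b ≠ (false, false) → a ≠ b →
      ∀ c : Submodule k g, IsCartanSubspace k g (qSpace k g σ₁ σ₂ a.1 a.2) c →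
        IsCartanSubspace k g
          (qSpace k g σ₁ σ₂ a.1 a.2 ⊔ qSpace k g σ₁ σ₂ b.1 b.2) c := by
  obtain ⟨hi1, hi2, -, hcm, hc12⟩ := h12
  have hi3 : IsInvolution k g (σ₂.trans σ₁) := by
    intro x
    simp only [LieEquiv.trans_apply]
    rw [← hcm, hi2, hi1]
  have m13 : ∀ x, σ₁ ((σ₂.trans σ₁) x) = (σ₂.trans σ₁) (σ₁ x) := by
    intro x
    simp only [LieEquiv.trans_apply]
    rw [hcm]
  have m23 : ∀ x, σ₂ ((σ₂.trans σ₁) x) = (σ₂.trans σ₁) (σ₂ x) := by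
    intro x
    simp only [LieEquiv.trans_apply]
    rw [← hcm]
  rintro ⟨a1, a2⟩ ⟨b1, b2⟩ ha hb hab c hc
  cases a1 <;> cases a2 <;> cases b1 <;> cases b2 <;> first
    | exact absurd rfl ha
    | exact absurd rfl hb
    | exact absurd rfl hab
    | skip
  -- (01, 10)
  · exact dyad_main k g _ _ hi3 hi2 (fun x => (m23 x).symm) (innerConj_symm k g h23) _ _
      (fun x => by
        rw [mem_qSpace, LieEquiv.trans_apply]
        constructor
        · rintro ⟨h1, h2⟩
          refine ⟨?_, by simpa using h2⟩
          simp only [Bool.false_eq_true, if_false, if_true, one_smul, neg_smul] at h1 h2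
          rw [h2, lieEquiv_neg, h1]
        · rintro ⟨h1, h2⟩
          simp only [Bool.false_eq_true, if_false, if_true, one_smul, neg_smul]
          rw [h2, lieEquiv_neg] at h1
          exact ⟨neg_injective h1, h2⟩)
      (fun x => by
        rw [mem_qSpace, LieEquiv.trans_apply]
        simp only [Bool.false_eq_true, if_false, if_true, one_smul, neg_smul]
        constructor
        · rintro ⟨h1, h2⟩
          rw [h2]; exact ⟨h1, rfl⟩
        · rintro ⟨h1, h2⟩
          rw [h2] at h1; exact ⟨h1, h2⟩) c hc
  -- (01, 11)
  · exact dyad_main k g _ _ hi2 hi3 m23 h23 _ _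
      (fun x => by
        rw [mem_qSpace, LieEquiv.trans_apply]
        simp only [Bool.false_eq_true, if_false, if_true, one_smul, neg_smul]
        constructor
        · rintro ⟨h1, h2⟩
          rw [h2, lieEquiv_neg, h1]; exact ⟨rfl, rfl⟩
        · rintro ⟨h1, h2⟩
          rw [h1, lieEquiv_neg] at h2
          exact ⟨neg_injective h2, h1⟩)
      (fun x => by
        rw [mem_qSpace, LieEquiv.trans_apply]
        simp only [if_true, one_smul, neg_smul]
        constructor
        · rintro ⟨h1, h2⟩
          rw [h2, lieEquiv_neg, h1]; exact ⟨rfl, neg_neg x⟩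
        · rintro ⟨h1, h2⟩
          rw [h1, lieEquiv_neg] at h2
          exact ⟨by rw [← neg_neg (σ₁ x), h2], h1⟩) c hc
  -- (10, 01)
  · exact dyad_main k g _ _ hi3 hi1 (fun x => (m13 x).symm) (innerConj_symm k g h13) _ _
      (fun x => by
        rw [mem_qSpace, LieEquiv.trans_apply, hcm]
        simp only [Bool.false_eq_true, if_false, if_true, one_smul, neg_smul]
        constructor
        · rintro ⟨h1, h2⟩
          rw [h1, lieEquiv_neg, h2]; exact ⟨rfl, rfl⟩
        · rintro ⟨h1, h2⟩
          rw [h2, lieEquiv_neg] at h1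
          exact ⟨h2, neg_injective h1⟩)
      (fun x => by
        rw [mem_qSpace, LieEquiv.trans_apply, hcm]
        simp only [Bool.false_eq_true, if_false, if_true, one_smul, neg_smul]
        constructor
        · rintro ⟨h1, h2⟩
          rw [h1]; exact ⟨h2, rfl⟩
        · rintro ⟨h1, h2⟩
          rw [h2] at h1; exact ⟨h2, h1⟩) c hc
  -- (10, 11)
  · exact dyad_main k g _ _ hi1 hi3 m13 h13 _ _
      (fun x => by
        rw [mem_qSpace, LieEquiv.trans_apply, hcm]
        simp only [Bool.false_eq_true, if_false, if_true, one_smul, neg_smul]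
        constructor
        · rintro ⟨h1, h2⟩
          rw [h1, lieEquiv_neg, h2]; exact ⟨rfl, rfl⟩
        · rintro ⟨h1, h2⟩
          rw [h1, lieEquiv_neg] at h2
          exact ⟨h1, neg_injective h2⟩)
      (fun x => by
        rw [mem_qSpace, LieEquiv.trans_apply, hcm]
        simp only [if_true, one_smul, neg_smul]
        constructor
        · rintro ⟨h1, h2⟩
          rw [h1, lieEquiv_neg, h2]; exact ⟨rfl, neg_neg x⟩
        · rintro ⟨h1, h2⟩
          rw [h1, lieEquiv_neg] at h2
          exact ⟨h1, by rw [← neg_neg (σ₂ x), h2]⟩) c hc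
  -- (11, 01)
  · exact dyad_main k g _ _ hi2 hi1 (fun x => (hcm x).symm) (innerConj_symm k g hc12) _ _
      (fun x => by
        rw [mem_qSpace]
        simp only [if_true, neg_smul, one_smul]
        exact and_comm)
      (fun x => by
        rw [mem_qSpace]
        simp only [Bool.false_eq_true, if_false, if_true, neg_smul, one_smul]
        exact and_comm) c hc
  -- (11, 10)
  · exact dyad_main k g _ _ hi1 hi2 hcm hc12 _ _
      (fun x => by
        rw [mem_qSpace]
        simp only [if_true, neg_smul, one_smul])
      (fun x => by
        rw [mem_qSpace]
        simp only [Bool.false_eq_true, if_false, if_true, neg_smul, one_smul]) c hc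
end

section
/- Let σ₁, σ₂ be commuting involutions of g with quaternionic decomposition g = g₀₀ ⊕ g₀₁ ⊕ g₁₀ ⊕ g₁₁, let (α, β, γ) be any permutation of the indices (01, 10, 11), and let x ∈ g_α. Then dim [g_β, x] = dim [g_γ, x], where [g_δ, x] denotes the image of g_δ under the map ad(x). -/
open LieAlgebra Module

variable (k : Type*) [Field k] [IsAlgClosed k] [CharZero k]
variable (g : Type*) [LieRing g] [LieAlgebra k g] [FiniteDimensional k g]
  [LieAlgebra.IsSemisimple k g]

theorem aux_rank_le {K V : Type*} [Field K] [AddCommGroup V] [Module K V] [FiniteDimensional K V]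
    (B : V →ₗ[K] V →ₗ[K] K) (f : V →ₗ[K] V) (hf : ∀ x y, B (f x) y = - B x (f y))
    (P Q : Submodule K V) (hPQ : ∀ p ∈ P, f p ∈ Q)
    (hQ : ∀ q ∈ Q, (∀ r ∈ Q, B q r = 0) → q = 0) :
    finrank K (Submodule.map f P) ≤ finrank K (Submodule.map f Q) := by
  let S : Q →ₗ[K] V := f ∘ₗ Q.subtype
  let T : V →ₗ[K] Module.Dual K Q := Q.subtype.dualMap ∘ₗ B
  have h1 : finrank K (Submodule.map T (Submodule.map f P)) = finrank K (Submodule.map f P) := by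
    rw [← LinearMap.range_domRestrict]
    apply LinearMap.finrank_range_of_inj
    rw [injective_iff_map_eq_zero]
    rintro ⟨_, ⟨p, hp, rfl⟩⟩ h0
    apply Subtype.ext
    refine hQ _ (hPQ p hp) (fun r hr => ?_)
    exact LinearMap.congr_fun h0 ⟨r, hr⟩
  have h2 : Submodule.map T (Submodule.map f P) ≤ LinearMap.range S.dualMap := by
    rintro _ ⟨_, ⟨p, hp, rfl⟩, rfl⟩
    refine ⟨-B p, ?_⟩
    ext q
    simp [S, T, hf]
  have h3 : LinearMap.range S = Submodule.map f Q := by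
    simp [S, LinearMap.range_comp]
  rw [← h1, ← h3, ← LinearMap.finrank_range_dualMap_eq_finrank_range]
  exact Submodule.finrank_mono h2

theorem aux_mem (σ₁ σ₂ : g ≃ₗ⁅k⁆ g) (b : Bool × Bool) (x : g) :
    x ∈ qSpace k g σ₁ σ₂ b.1 b.2 ↔ σ₁ x = (if b.1 then (-1 : k) else 1) • x ∧
      σ₂ x = (if b.2 then (-1 : k) else 1) • x := by
  simp only [qSpace, eigSub, Submodule.mem_inf, Module.End.mem_eigenspace_iff]
  rfl

theorem aux_nondeg (σ₁ σ₂ : g ≃ₗ⁅k⁆ g) (hcomm : CommutingInvolutions k g σ₁ σ₂)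
    (b : Bool × Bool) (q : g) (hq : q ∈ qSpace k g σ₁ σ₂ b.1 b.2)
    (h : ∀ r ∈ qSpace k g σ₁ σ₂ b.1 b.2, killingForm k g q r = 0) : q = 0 := by
  obtain ⟨i1, i2, hc⟩ := hcomm
  have hK : LieAlgebra.IsKilling k g := (LieAlgebra.hasTrivialRadical_iff_isKilling k g).mp inferInstance
  rw [aux_mem] at hq
  have main : ∀ e d : k, e * e = 1 → d * d = 1 → σ₁ q = e • q → σ₂ q = d • q →
      (∀ r, σ₁ r = e • r → σ₂ r = d • r → killingForm k g q r = 0) → q = 0 := by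
    intro e d he hd h1 h2 h
    have hk1 : ∀ y, killingForm k g q (σ₁ y) = e * killingForm k g q y := by
      intro y
      have := LieAlgebra.killingForm_of_equiv_apply (R := k) σ₁ q y
      rw [← this, h1, map_smul, LinearMap.smul_apply, smul_eq_mul, ← mul_assoc, he, one_mul]
    have hk2 : ∀ y, killingForm k g q (σ₂ y) = d * killingForm k g q y := by
      intro y
      have := LieAlgebra.killingForm_of_equiv_apply (R := k) σ₂ q y
      rw [← this, h2, map_smul, LinearMap.smul_apply, smul_eq_mul, ← mul_assoc, hd, one_mul]
    have : q ∈ LinearMap.ker (killingForm k g) := by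
      rw [LinearMap.mem_ker]
      ext y
      have key := h (y + e • σ₁ y + d • σ₂ y + (e * d) • σ₁ (σ₂ y)) ?_ ?_
      · simp only [map_add, map_smul, hk1, hk2, smul_eq_mul] at key
        have : (4 : k) * killingForm k g q y = 0 := by
          linear_combination key - (killingForm k g q y) * he - (killingForm k g q y) * hd -
            (killingForm k g q y) * (d * d * he + hd)
        simpa using this
      · simp only [map_add, map_smul, i1 _, smul_add, smul_smul]
        rw [he, ← mul_assoc, he]
        simp only [one_smul, one_mul]
        abel
      · simp only [map_add, map_smul, ← hc, i2 _, smul_add, smul_smul]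
        rw [hd, mul_comm e d, ← mul_assoc, hd]
        simp only [one_smul, one_mul]
        abel
    rwa [LieAlgebra.IsKilling.ker_killingForm_eq_bot, Submodule.mem_bot] at this
  refine main _ _ ?_ ?_ hq.1 hq.2 (fun r h1 h2 => h r ((aux_mem k g σ₁ σ₂ b r).2 ⟨h1, h2⟩))
  · split <;> simp
  · split <;> simp

theorem aux_le (σ₁ σ₂ : g ≃ₗ⁅k⁆ g) (hcomm : CommutingInvolutions k g σ₁ σ₂)
    (a b c : Bool × Bool) (ha : a ≠ (false, false)) (hb : b ≠ (false, false))
    (hc : c ≠ (false, false)) (hab : a ≠ b) (hac : a ≠ c) (hbc : b ≠ c)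
    (x : g) (hx : x ∈ qSpace k g σ₁ σ₂ a.1 a.2) :
    finrank k (Submodule.map (ad k g x) (qSpace k g σ₁ σ₂ b.1 b.2)) ≤
      finrank k (Submodule.map (ad k g x) (qSpace k g σ₁ σ₂ c.1 c.2)) := by
  refine aux_rank_le (killingForm k g) (ad k g x) ?_ _ _ ?_ (aux_nondeg k g σ₁ σ₂ hcomm c)
  · intro y z
    simp only [ad_apply]
    exact LieModule.traceForm_apply_lie_apply' k g g x y z
  · intro p hp
    rw [aux_mem] at hx hp ⊢
    obtain ⟨a1, a2⟩ := a
    obtain ⟨b1, b2⟩ := b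
    obtain ⟨c1, c2⟩ := c
    simp only [ad_apply, LieEquiv.map_lie, hx.1, hx.2, hp.1, hp.2, smul_lie, lie_smul, smul_smul]
    revert ha hb hc hab hac hbc
    clear hx hp
    cases a1 <;> cases a2 <;> cases b1 <;> cases b2 <;> cases c1 <;> cases c2 <;> simp

/-- For any permutation `(α, β, γ)` of the indices `(01, 10, 11)` of
the quaternionic decomposition and any `x ∈ g_α`, one has
`dim [g_β, x] = dim [g_γ, x]`. -/
theorem dim_ad_image_eq (σ₁ σ₂ : g ≃ₗ⁅k⁆ g)
    (hcomm : CommutingInvolutions k g σ₁ σ₂) :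
    ∀ a b c : Bool × Bool,
      a ≠ (false, false) → b ≠ (false, false) → c ≠ (false, false) →
      a ≠ b → a ≠ c → b ≠ c →
      ∀ x ∈ qSpace k g σ₁ σ₂ a.1 a.2,
        Module.finrank k (Submodule.map (ad k g x) (qSpace k g σ₁ σ₂ b.1 b.2)) =
          Module.finrank k (Submodule.map (ad k g x) (qSpace k g σ₁ σ₂ c.1 c.2)) := by
  intro a b c ha hb hc hab hac hbc x hx
  exact le_antisymm (aux_le k g σ₁ σ₂ hcomm a b c ha hb hc hab hac hbc x hx)
    (aux_le k g σ₁ σ₂ hcomm a c b ha hc hb hac hab hbc.symm x hx)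
end

section
/- Let σ₁, σ₂ be commuting involutions of g with quaternionic decomposition g = g₀₀ ⊕ g₀₁ ⊕ g₁₀ ⊕ g₁₁, and let (α, β, γ) be any permutation of the indices (01, 10, 11). Then there exists x ∈ g_α such that [g_β, x] = g_γ (the image of g_β under ad(x) is all of g_γ) if and only if every Cartan subspace of g_α is also a Cartan subspace of g_α ⊕ g_γ. -/
open LieAlgebra Module

variable (k : Type*) [Field k] [IsAlgClosed k] [CharZero k]
variable (g : Type*) [LieRing g] [LieAlgebra k g] [FiniteDimensional k g]
  [LieAlgebra.IsSemisimple k g]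

set_option linter.all false
open Module.End in
lemma ss_part_derivation (y : g) (S : Module.End k g) (hc : Commute (ad k g y) S)
    (hS : S.IsSemisimple) (hN : IsNilpotent (ad k g y - S)) (a b : g) :
    S ⁅a, b⁆ = ⁅S a, b⁆ + ⁅a, S b⁆ := by
  have aux {μ : k} {z : g} (hz : z ∈ (ad k g y).maxGenEigenspace μ) : S z = μ • z := by
    rw [maxGenEigenspace_eq] at hz
    rw [apply_eq_of_mem_of_comm_of_isFinitelySemisimple_of_isNil hz hc hS.isFinitelySemisimple hN]
  have h_der (a b : g) (μ ν : k) (ha : a ∈ (ad k g y).maxGenEigenspace μ)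
      (hb : b ∈ (ad k g y).maxGenEigenspace ν) : S ⁅a, b⁆ = ⁅S a, b⁆ + ⁅a, S b⁆ := by
    have hab : ⁅a, b⁆ ∈ (ad k g y).maxGenEigenspace (μ + ν) :=
      LieModule.lie_mem_maxGenEigenspace_toEnd ha hb
    rw [aux ha, aux hb, aux hab, smul_lie, lie_smul, ← add_smul]
  have ha : a ∈ ⨆ μ : k, (ad k g y).maxGenEigenspace μ := by
    rw [iSup_maxGenEigenspace_eq_top]; trivial
  have hb : b ∈ ⨆ μ : k, (ad k g y).maxGenEigenspace μ := by
    rw [iSup_maxGenEigenspace_eq_top]; trivial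
  induction ha using Submodule.iSup_induction' with
  | mem α y hy =>
    induction hb using Submodule.iSup_induction' with
    | mem β z hz => exact h_der _ _ α β hy hz
    | zero => simp
    | add _ _ _ _ h h' => simp only [lie_add, map_add, h, h']; abel
  | zero => simp
  | add _ _ _ _ h h' => simp only [add_lie, map_add, h, h']; abel

lemma ad_inj {a b : g} (h : ad k g a = ad k g b) : a = b := by
  have : ad k g (a - b) = 0 := by rw [map_sub, h, sub_self]
  have h2 : LieDerivation.ad k g (a - b) = 0 := by
    ext z
    have := LinearMap.congr_fun this z
    simpa using this
  rw [LieDerivation.IsKilling.ad_apply_eq_zero_iff] at h2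
  exact sub_eq_zero.mp h2

lemma exists_jordan_s18 (y : g) : ∃ s n : g, y = n + s ∧ IsSSElt k g s ∧ IsNilpotent (ad k g n) ∧
    ad k g s ∈ Algebra.adjoin k {ad k g y} ∧ Commute (ad k g n) (ad k g s) := by
  obtain ⟨N, hN0, S, hS0, hN, hS, hSN⟩ := (ad k g y).exists_isNilpotent_isSemisimple
  have hc : Commute (ad k g y) S := Algebra.commute_of_mem_adjoin_self hS0
  have hN' : IsNilpotent (ad k g y - S) := by rwa [hSN, add_sub_cancel_right]
  have hder := ss_part_derivation k g y S hc hS hN'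
  have hder' : ∀ a b : g, S ⁅a, b⁆ = ⁅a, S b⁆ - ⁅b, S a⁆ := by
    intro a b; rw [hder, ← lie_skew (S a) b]; abel
  let S' : LieDerivation k g g := ⟨S, hder'⟩
  obtain ⟨s, hs⟩ := LieDerivation.IsKilling.exists_eq_ad S'
  have hs' : ad k g s = S := by rw [← LieDerivation.coe_ad_apply_eq_ad_apply s, hs]
  have hn : ad k g (y - s) = N := by rw [map_sub, hs', hSN, add_sub_cancel_right]
  refine ⟨s, y - s, by abel, ?_, ?_, ?_, ?_⟩
  · rw [IsSSElt, hs']; exact hS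
  · rw [hn]; exact hN
  · rw [hs']; exact hS0
  · rw [map_sub, hs']; exact hc.sub_left (Commute.refl _)

lemma jordan_eigen (σ : g ≃ₗ⁅k⁆ g) (ε : k) (hε : ε ≠ 0) (s n : g) (hs : IsSSElt k g s)
    (hn : IsNilpotent (ad k g n)) (hc : Commute (ad k g n) (ad k g s))
    (h : σ (n + s) = ε • (n + s)) : σ s = ε • s := by
  have conj : ∀ x, ad k g (σ x) = σ.toLinearEquiv.conj (ad k g x) := fun x ↦
    (LieAlgebra.conj_ad_apply σ x).symm
  have h1 : IsNilpotent (ad k g (σ n)) := by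
    rw [conj]
    exact hn.map (σ.toLinearEquiv.conjRingEquiv)
  have h2 : (ad k g (σ s)).IsSemisimple := by
    refine (LinearEquiv.isSemisimple_iff (ad k g s) (ad k g (σ s)) σ.toLinearEquiv ?_).mp hs
    ext z
    simpa using LieEquiv.map_lie σ s z
  have h3 : Commute (ad k g (σ n)) (ad k g (σ s)) := by
    rw [conj, conj]
    exact hc.map (σ.toLinearEquiv.conjRingEquiv)
  have h4 : IsNilpotent (ad k g (ε • n)) := by
    rw [map_smul]; exact hn.smul ε
  have h5 : (ad k g (ε • s)).IsSemisimple := by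
    rw [map_smul]; exact Module.End.IsSemisimple_smul ε hs
  have h6 : Commute (ad k g (ε • n)) (ad k g (ε • s)) := by
    rw [map_smul, map_smul]; exact (hc.smul_left ε).smul_right ε
  have := Module.End.isNilpotent_isSemisimple_unique h1 h2 h4 h5 h3 h6 (by
    rw [← map_add, ← map_add, ← map_add, h, smul_add])
  exact ad_inj k g this.2

lemma commute_of_lie_eq_zero {x y : g} (h : ⁅x, y⁆ = 0) : Commute (ad k g x) (ad k g y) := by
  refine LinearMap.ext fun z ↦ ?_
  simp only [Module.End.mul_apply, ad_apply]
  rw [leibniz_lie, h, zero_lie, zero_add]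

lemma lie_eq_zero_of_commute {x y : g} (h : Commute (ad k g x) (ad k g y)) : ⁅x, y⁆ = 0 := by
  apply ad_inj k g
  refine LinearMap.ext fun z ↦ ?_
  have := LinearMap.congr_fun h.eq z
  simp only [Module.End.mul_apply, ad_apply] at this
  rw [ad_apply, lie_lie, this, sub_self, map_zero, LinearMap.zero_apply]

/-- generic combination of two commuting semisimple endomorphisms -/
lemma exists_generic_pair {V : Type*} [AddCommGroup V] [Module k V] [FiniteDimensional k V]
    (f h : Module.End k V) (hc : Commute f h) (hf : f.IsSemisimple) (hh : h.IsSemisimple) :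
    ∃ t : k, ∀ v, (f + t • h) v = 0 → f v = 0 ∧ h v = 0 := by
  classical
  have fin : ∀ u : Module.End k V, {μ : k | u.HasEigenvalue μ}.Finite := fun u ↦
    Module.End.finite_hasEigenvalue u
  have hfin : ((fun p : k × k ↦ - p.1 / p.2) '' ({μ : k | f.HasEigenvalue μ} ×ˢ
    {μ : k | h.HasEigenvalue μ})).Finite := ((fin f).prod (fin h)).image _
  obtain ⟨t, ht⟩ := Set.Infinite.exists_notMem_finite (Set.infinite_univ (α := k)) hfin
  refine ⟨t, ?_⟩
  have ht := ht.2
  set W := LinearMap.ker (f + t • h) with hW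
  have hWf : ∀ v ∈ W, f v ∈ W := by
    intro v hv
    have e : (f + t • h) (f v) = f ((f + t • h) v) := by
      have := LinearMap.congr_fun hc.eq v
      simp only [Module.End.mul_apply] at this
      simp [this]
    rw [hW, LinearMap.mem_ker, e, LinearMap.mem_ker.mp hv, map_zero]
  have hWh : ∀ v ∈ W, h v ∈ W := by
    intro v hv
    have e : (f + t • h) (h v) = h ((f + t • h) v) := by
      have := LinearMap.congr_fun hc.eq v
      simp only [Module.End.mul_apply] at this
      simp [this]
    rw [hW, LinearMap.mem_ker, e, LinearMap.mem_ker.mp hv, map_zero]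
  have hss : Module.End.IsSemisimple (LinearMap.restrict h hWh) := hh.restrict hWh
  have h0 : LinearMap.restrict h hWh = 0 := by
    rw [hss.eq_zero_iff_forall_eigenvalue]
    intro μ hμ
    by_contra hμ0
    obtain ⟨w, hw⟩ := hμ.exists_hasEigenvector
    have hw1 : h w = μ • (w : V) := by
      have := hw.apply_eq_smul
      simpa using congrArg Subtype.val this
    have hw0 : (w : V) ≠ 0 := by simpa using hw.2
    have hfw : f w = (-(t * μ)) • (w : V) := by
      have := LinearMap.mem_ker.mp w.2
      simp only [LinearMap.add_apply, LinearMap.smul_apply, hw1] at this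
      rw [eq_neg_of_add_eq_zero_left this, smul_smul, neg_smul]
    apply ht
    refine ⟨(-(t*μ), μ), ⟨?_, ?_⟩, by field_simp⟩
    · exact Module.End.hasEigenvalue_of_hasEigenvector (x := (w : V))
        ⟨Module.End.mem_eigenspace_iff.mpr hfw, hw0⟩
    · exact Module.End.hasEigenvalue_of_hasEigenvector (x := (w : V))
        ⟨Module.End.mem_eigenspace_iff.mpr hw1, hw0⟩
  intro v hv
  have hv0 : h v = 0 := by
    have := LinearMap.congr_fun h0 ⟨v, hv⟩
    simpa using congrArg Subtype.val this
  refine ⟨?_, hv0⟩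
  simpa [hv0] using hv

lemma exists_generic_s18 (c : Submodule k g) (hss : ∀ x ∈ c, IsSSElt k g x)
    (hab : ∀ x ∈ c, ∀ y ∈ c, ⁅x, y⁆ = 0) :
    ∃ x ∈ c, ∀ v : g, ⁅x, v⁆ = 0 → ∀ e ∈ c, ⁅e, v⁆ = 0 := by
  classical
  let P : ℕ → Prop := fun n ↦ ∃ x ∈ c, Module.finrank k (LinearMap.ker (ad k g x)) = n
  have hP : ∃ n, P n := ⟨_, 0, c.zero_mem, rfl⟩
  obtain ⟨x, hx, hxn⟩ := Nat.find_spec hP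
  refine ⟨x, hx, fun v hv e he ↦ ?_⟩
  obtain ⟨t, ht⟩ := exists_generic_pair k (ad k g x) (ad k g e)
    (commute_of_lie_eq_zero k g (hab x hx e he)) (hss x hx) (hss e he)
  have hle : LinearMap.ker (ad k g (x + t • e)) ≤ LinearMap.ker (ad k g x) := by
    intro w hw
    rw [LinearMap.mem_ker, map_add, map_smul] at hw
    exact LinearMap.mem_ker.mpr (ht w hw).1
  have hmin := Nat.find_min' hP ⟨x + t • e, c.add_mem hx (c.smul_mem t he), rfl⟩
  have heq := Submodule.eq_of_le_of_finrank_le hle (by rw [hxn]; exact hmin)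
  have : v ∈ LinearMap.ker (ad k g (x + t • e)) := by
    rw [heq]; exact LinearMap.mem_ker.mpr (by simpa using hv)
  rw [LinearMap.mem_ker, map_add, map_smul] at this
  simpa using (ht v this).2

lemma isCompl_of_ss {V : Type*} [AddCommGroup V] [Module k V] [FiniteDimensional k V]
    (f : Module.End k V) (hf : f.IsSemisimple) :
    IsCompl (LinearMap.ker f) (LinearMap.range f) := by
  obtain ⟨q, hq, hc⟩ := Module.End.isSemisimple_iff.mp hf (LinearMap.ker f) (by
    intro v hv
    rw [Submodule.mem_comap, LinearMap.mem_ker, LinearMap.mem_ker.mp hv, map_zero])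
  have hle : LinearMap.range f ≤ q := by
    rintro _ ⟨v, rfl⟩
    have hv : v ∈ LinearMap.ker f ⊔ q := by rw [hc.sup_eq_top]; trivial
    obtain ⟨a, ha, b, hb, rfl⟩ := Submodule.mem_sup.mp hv
    rw [map_add, LinearMap.mem_ker.mp ha, zero_add]
    exact hq hb
  have hd : Disjoint (LinearMap.ker f) (LinearMap.range f) := hc.disjoint.mono_right hle
  refine (Submodule.isCompl_iff_disjoint _ _ ?_).mpr hd
  rw [add_comm, LinearMap.finrank_range_add_finrank_ker]

lemma ss_decomp (θ η : g ≃ₗ⁅k⁆ g) (hθθ : ∀ x, θ (θ x) = x) (hηη : ∀ x, η (η x) = x)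
    (hθη : ∀ x, θ (η x) = η (θ x)) (y : g) (hy : IsSSElt k g y) (hθ : θ y = -y) (hη : η y = y)
    (a : g) (ε₁ ε₂ : k) (h₁ : ε₁ = 1 ∨ ε₁ = -1) (h₂ : ε₂ = 1 ∨ ε₂ = -1)
    (ha₁ : θ a = ε₁ • a) (ha₂ : η a = ε₂ • a) :
    ∃ u w : g, a = u + ⁅y, w⁆ ∧ ⁅y, u⁆ = 0 ∧ θ u = ε₁ • u ∧ η u = ε₂ • u ∧
      θ w = (-ε₁) • w ∧ η w = ε₂ • w := by
  have hc := isCompl_of_ss k (ad k g y) hy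
  have ha : a ∈ LinearMap.ker (ad k g y) ⊔ LinearMap.range (ad k g y) := by
    rw [hc.sup_eq_top]; trivial
  obtain ⟨u, hu, _, ⟨w, rfl⟩, rfl⟩ := Submodule.mem_sup.mp ha
  rw [LinearMap.mem_ker] at hu
  simp only [ad_apply] at *
  have e1 : θ ⁅y, u⁆ = 0 := by rw [hu, map_zero]
  have e2 : η ⁅y, u⁆ = 0 := by rw [hu, map_zero]
  have e3 : θ (η ⁅y, u⁆) = 0 := by rw [hu, map_zero, map_zero]
  rw [LieEquiv.map_lie, LieEquiv.map_lie, hη, hθ, neg_lie, neg_eq_zero] at e3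
  rw [LieEquiv.map_lie, hθ, neg_lie, neg_eq_zero] at e1
  rw [LieEquiv.map_lie, hη] at e2
  have f1 : θ (u + ⁅y, w⁆) = θ u - ⁅y, θ w⁆ := by
    rw [map_add, LieEquiv.map_lie, hθ, neg_lie, sub_eq_add_neg]
  have f2 : η (u + ⁅y, w⁆) = η u + ⁅y, η w⁆ := by
    rw [map_add, LieEquiv.map_lie, hη]
  have f3 : θ (η (u + ⁅y, w⁆)) = θ (η u) - ⁅y, θ (η w)⁆ := by
    rw [f2, map_add, LieEquiv.map_lie, hθ, neg_lie, sub_eq_add_neg]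
  have f4 : θ (η (u + ⁅y, w⁆)) = (ε₁ * ε₂) • (u + ⁅y, w⁆) := by
    rw [ha₂, map_smul, ha₁, smul_smul, mul_comm]
  rw [f3] at f4
  rw [f1] at ha₁
  rw [f2] at ha₂
  set a := u + ⁅y, w⁆ with haa
  have f5 : (4 : k) • a = (u + ⁅y, w⁆) + ε₁ • (θ u - ⁅y, θ w⁆) + ε₂ • (η u + ⁅y, η w⁆)
      + (ε₁ * ε₂) • (θ (η u) - ⁅y, θ (η w)⁆) := by
    rw [ha₁, ha₂, f4, ← haa]
    rcases h₁ with rfl | rfl <;> rcases h₂ with rfl | rfl <;> module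
  have h4 : (4 : k) ≠ 0 := by norm_num
  refine ⟨(4 : k)⁻¹ • (u + ε₁ • θ u + ε₂ • η u + (ε₁ * ε₂) • θ (η u)),
    (4 : k)⁻¹ • (w - ε₁ • θ w + ε₂ • η w - (ε₁ * ε₂) • θ (η w)), ?_, ?_, ?_, ?_, ?_, ?_⟩
  · rw [lie_smul, ← smul_add, eq_inv_smul_iff₀ h4, f5]
    simp only [lie_add, lie_sub, lie_smul]
    module
  · simp [lie_add, lie_smul, hu, e1, e2, e3]
  all_goals
    simp only [map_smul, map_add, map_sub, hθθ, hηη, ← hθη]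
    rcases h₁ with rfl | rfl <;> rcases h₂ with rfl | rfl <;> module

lemma killing_nilp {n e : g} (hn : IsNilpotent (ad k g n)) (h : ⁅e, n⁆ = 0) :
    killingForm k g n e = 0 := by
  rw [killingForm_apply_apply]
  have hc : Commute (ad k g n) (ad k g e) := (commute_of_lie_eq_zero k g h).symm
  exact (LinearMap.isNilpotent_trace_of_isNilpotent (hc.isNilpotent_mul_right hn)).eq_zero

lemma cartan_centralizer (θ η : g ≃ₗ⁅k⁆ g) (hθθ : ∀ x, θ (θ x) = x) (hηη : ∀ x, η (η x) = x)
    (hθη : ∀ x, θ (η x) = η (θ x)) (m c : Submodule k g)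
    (hm : ∀ x, x ∈ m ↔ θ x = -x ∧ η x = x) (hC : IsCartanSubspace k g m c)
    (v : g) (hv : v ∈ m) (hvc : ∀ e ∈ c, ⁅e, v⁆ = 0) : v ∈ c := by
  obtain ⟨hcm, hss, hab, hmax⟩ := hC
  have hJ : ∀ v ∈ m, (∀ e ∈ c, ⁅e, v⁆ = 0) → ∃ s ∈ c, ∃ n ∈ m, (∀ e ∈ c, ⁅e, n⁆ = 0) ∧
      v = n + s ∧ IsNilpotent (ad k g n) := by
    intro v hv hvc
    obtain ⟨s, n, rfl, hs, hn, hadj, hcom⟩ := exists_jordan_s18 k g v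
    have hsm : s ∈ m := by
      obtain ⟨h1, h2⟩ := (hm _).mp hv
      rw [hm]
      have a1 := jordan_eigen k g θ (-1) (by norm_num) s n hs hn hcom (by rw [h1, neg_one_smul])
      have a2 := jordan_eigen k g η 1 (by norm_num) s n hs hn hcom (by rw [h2, one_smul])
      exact ⟨by simpa using a1, by simpa using a2⟩
    have hse : ∀ e ∈ c, ⁅e, s⁆ = 0 := fun e he ↦ lie_eq_zero_of_commute k g
      (Algebra.commute_of_mem_adjoin_singleton_of_commute hadj
        (commute_of_lie_eq_zero k g (hvc e he)))
    have hsc : s ∈ c := by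
      have key := hmax (c ⊔ Submodule.span k {s}) (sup_le hcm (by simpa using hsm)) ?_ ?_ le_sup_left
      · rw [← key]
        exact Submodule.mem_sup_right (Submodule.mem_span_singleton_self s)
      · intro x hx
        obtain ⟨e, he, _, hf, rfl⟩ := Submodule.mem_sup.mp hx
        obtain ⟨t, rfl⟩ := Submodule.mem_span_singleton.mp hf
        rw [IsSSElt, map_add, map_smul]
        exact Module.End.IsSemisimple.add_of_commute
          ((commute_of_lie_eq_zero k g (hse e he)).smul_right t) (hss e he)
          (Module.End.IsSemisimple_smul t hs)
      · intro x hx y hy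
        obtain ⟨e, he, _, hf, rfl⟩ := Submodule.mem_sup.mp hx
        obtain ⟨t, rfl⟩ := Submodule.mem_span_singleton.mp hf
        obtain ⟨e', he', _, hf', rfl⟩ := Submodule.mem_sup.mp hy
        obtain ⟨t', rfl⟩ := Submodule.mem_span_singleton.mp hf'
        have : ⁅s, e'⁆ = 0 := by rw [← lie_skew, hse e' he', neg_zero]
        simp [hab e he e' he', hse e he, this]
    refine ⟨s, hsc, n, ?_, ?_, rfl, hn⟩
    · have := m.sub_mem hv hsm
      simpa using this
    · intro e he
      have h1 := hvc e he
      rwa [lie_add, hse e he, add_zero] at h1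
  -- nondegeneracy
  have hnd : ∀ v ∈ m, (∀ e ∈ c, ⁅e, v⁆ = 0) →
      (∀ w ∈ m, (∀ e ∈ c, ⁅e, w⁆ = 0) → killingForm k g v w = 0) → v = 0 := by
    intro v hv hvc hvw
    obtain ⟨x, hx, hgen⟩ := exists_generic_s18 k g c hss hab
    have hall : ∀ b ∈ m, killingForm k g v b = 0 := by
      intro b hb
      obtain ⟨x1, x2⟩ := (hm _).mp (hcm hx)
      obtain ⟨b1, b2⟩ := (hm _).mp hb
      obtain ⟨u, w, hbu, hu, hu1, hu2, -, -⟩ := ss_decomp k g θ η hθθ hηη hθη x (hss x hx) x1 x2 b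
        (-1) 1 (Or.inr rfl) (Or.inl rfl) (by simpa using b1) (by simpa using b2)
      rw [hbu, map_add, hvw u ((hm u).mpr ⟨by simpa using hu1, by simpa using hu2⟩) (hgen u hu),
        zero_add]
      rw [← LieModule.traceForm_apply_lie_apply, ← lie_skew, hvc x hx]
      simp
    obtain ⟨v1, v2⟩ := (hm _).mp hv
    have hall' : ∀ b, killingForm k g v b = 0 := by
      intro b
      have k1 : ∀ b, killingForm k g v (θ b) = - killingForm k g v b := by
        intro b
        rw [← killingForm_of_equiv_apply θ v b, v1]; simp
      have k2 : ∀ b, killingForm k g v (η b) = killingForm k g v b := by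
        intro b
        rw [← killingForm_of_equiv_apply η v b, v2]
      have := hall (b - θ b + η b - θ (η b)) ((hm _).mpr ⟨by
        simp only [map_sub, map_add, hθθ]; abel, by
        simp only [map_sub, map_add, hηη, ← hθη]; abel⟩)
      simp only [map_sub, map_add, k1, k2] at this
      have h4 : (4 : k) * killingForm k g v b = 0 := by linear_combination this
      simpa using h4
    have hker : v ∈ LinearMap.ker (killingForm k g) := LinearMap.mem_ker.mpr (LinearMap.ext hall')
    rw [LieAlgebra.IsKilling.ker_killingForm_eq_bot] at hker
    simpa using hker
  have hnil : ∀ n ∈ m, (∀ e ∈ c, ⁅e, n⁆ = 0) → IsNilpotent (ad k g n) → n = 0 := by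
    intro n hn hnc hnn
    refine hnd n hn hnc fun w hw hwc ↦ ?_
    obtain ⟨s, hs, n', hn', hnc', rfl, hnn'⟩ := hJ w hw hwc
    rw [map_add, killing_nilp k g hnn (hnc s hs), add_zero]
    obtain ⟨s'', hs'', n'', hn'', hnc'', heq, hnn''⟩ := hJ (n + n') (m.add_mem hn hn')
      (fun e he ↦ by rw [lie_add, hnc e he, hnc' e he, add_zero])
    have q1 : killingForm k g (n + n') s'' = 0 := by
      rw [map_add, LinearMap.add_apply, killing_nilp k g hnn (hnc _ hs''),
        killing_nilp k g hnn' (hnc' _ hs''), add_zero]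
    have q2 : killingForm k g s'' s'' = 0 := by
      rw [heq, map_add, LinearMap.add_apply, killing_nilp k g hnn'' (hnc'' _ hs''), zero_add] at q1
      exact q1
    have q3 : killingForm k g (n + n') (n + n') = 0 := by
      rw [heq]
      simp only [map_add, LinearMap.add_apply]
      rw [LieModule.traceForm_comm k g g s'' n'', killing_nilp k g hnn'' (hnc'' _ hs''), q2,
        killing_nilp k g hnn'' (lie_self _)]
      simp
    simp only [map_add, LinearMap.add_apply] at q3
    rw [LieModule.traceForm_comm k g g n' n, killing_nilp k g hnn (lie_self _),
      killing_nilp k g hnn' (lie_self _)] at q3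
    have : (2 : k) * killingForm k g n n' = 0 := by linear_combination q3
    simpa using this
  obtain ⟨s, hs, n, hn, hnc, rfl, hnn⟩ := hJ v hv hvc
  rw [hnil n hn hnc hnn, zero_add]
  exact hs

lemma exists_cartan (m : Submodule k g) : ∃ c, IsCartanSubspace k g m c := by
  let S : Set (Submodule k g) := {c | c ≤ m ∧ (∀ x ∈ c, IsSSElt k g x) ∧
    (∀ x ∈ c, ∀ y ∈ c, ⁅x, y⁆ = 0)}
  have hne : S.Nonempty := by
    refine ⟨⊥, bot_le, ?_, ?_⟩
    · intro x hx
      rw [(Submodule.mem_bot k).mp hx, IsSSElt, map_zero]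
      exact Module.End.isSemisimple_zero
    · intro x hx y hy
      rw [(Submodule.mem_bot k).mp hx, zero_lie]
  obtain ⟨c, hc, hmax⟩ := (wellFounded_gt (α := Submodule k g)).has_min S hne
  refine ⟨c, hc.1, hc.2.1, hc.2.2, fun c' h1 h2 h3 h4 ↦ ?_⟩
  by_contra hne
  exact hmax c' ⟨h1, h2, h3⟩ (lt_of_le_of_ne h4 (Ne.symm hne))

lemma mem_sup_iff (θ η : g ≃ₗ⁅k⁆ g) (hθθ : ∀ x, θ (θ x) = x) (hηη : ∀ x, η (η x) = x)
    (hθη : ∀ x, θ (η x) = η (θ x)) (Ga Gc : Submodule k g)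
    (ha : ∀ x, x ∈ Ga ↔ θ x = -x ∧ η x = x) (hc : ∀ x, x ∈ Gc ↔ θ x = -x ∧ η x = -x) (x : g) :
    x ∈ Ga ⊔ Gc ↔ θ x = -x := by
  constructor
  · intro hx
    obtain ⟨y, hy, z, hz, rfl⟩ := Submodule.mem_sup.mp hx
    rw [map_add, ((ha y).mp hy).1, ((hc z).mp hz).1]; abel
  · intro hx
    have h2 : (2 : k) ≠ 0 := by norm_num
    have : x = (2 : k)⁻¹ • (x + η x) + (2 : k)⁻¹ • (x - η x) := by
      rw [← smul_add, eq_inv_smul_iff₀ h2]; module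
    rw [this]
    refine Submodule.add_mem_sup (Ga.smul_mem _ ((ha _).mpr ?_)) (Gc.smul_mem _ ((hc _).mpr ?_))
    · rw [map_add, map_add, hθη, hx, hηη, map_neg]
      exact ⟨by abel, by abel⟩
    · rw [map_sub, map_sub, hθη, hx, hηη, map_neg]
      exact ⟨by abel, by abel⟩

lemma eq_zero_of_neg {x : g} (h0 : (1 : k) • x = -x) : x = 0 := by
  have h : x = -x := by rwa [one_smul] at h0
  have h2 : (2 : k) • x = 0 := by
    rw [two_smul]; nth_rewrite 1 [h]; abel
  exact (smul_eq_zero.mp h2).resolve_left (by norm_num)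

lemma core_backward (θ η : g ≃ₗ⁅k⁆ g) (hθθ : ∀ x, θ (θ x) = x) (hηη : ∀ x, η (η x) = x)
    (hθη : ∀ x, θ (η x) = η (θ x)) (Ga Gb Gc : Submodule k g)
    (ha : ∀ x, x ∈ Ga ↔ θ x = -x ∧ η x = x) (hb : ∀ x, x ∈ Gb ↔ θ x = x ∧ η x = -x)
    (hc : ∀ x, x ∈ Gc ↔ θ x = -x ∧ η x = -x)
    (h : ∀ cs, IsCartanSubspace k g Ga cs → IsCartanSubspace k g (Ga ⊔ Gc) cs) :
    ∃ x ∈ Ga, Submodule.map (ad k g x) Gb = Gc := by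
  obtain ⟨cs, hcs⟩ := exists_cartan k g Ga
  have hcs' := h cs hcs
  obtain ⟨x, hx, hgen⟩ := exists_generic_s18 k g cs hcs.2.1 hcs.2.2.1
  have hxa := (ha x).mp (hcs.1 hx)
  have hz : ∀ v ∈ Gc, ⁅x, v⁆ = 0 → v = 0 := by
    intro v hv hxv
    have := cartan_centralizer k g θ LieEquiv.refl hθθ (fun _ ↦ rfl) (fun _ ↦ rfl) (Ga ⊔ Gc) cs
      (fun x ↦ by rw [mem_sup_iff k g θ η hθθ hηη hθη Ga Gc ha hc]; simp) hcs' v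
      (Submodule.mem_sup_right hv) (hgen v hxv)
    have h1 := ((ha v).mp (hcs.1 this)).2
    have h2 := ((hc v).mp hv).2
    exact eq_zero_of_neg k g (by rw [one_smul]; exact h1.symm.trans h2)
  refine ⟨x, hcs.1 hx, le_antisymm ?_ ?_⟩
  · rintro _ ⟨w, hw, rfl⟩
    obtain ⟨w1, w2⟩ := (hb w).mp hw
    rw [ad_apply, hc, LieEquiv.map_lie, LieEquiv.map_lie, hxa.1, hxa.2, w1, w2]
    simp
  · intro a haa
    obtain ⟨a1, a2⟩ := (hc a).mp haa
    obtain ⟨u, w, rfl, hu, hu1, hu2, hw1, hw2⟩ := ss_decomp k g θ η hθθ hηη hθη x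
      (hcs.2.1 x hx) hxa.1 hxa.2 a (-1) (-1) (Or.inr rfl) (Or.inr rfl)
      (by simpa using a1) (by simpa using a2)
    rw [hz u ((hc u).mpr ⟨by simpa using hu1, by simpa using hu2⟩) hu, zero_add]
    exact ⟨w, (hb w).mpr ⟨by simpa using hw1, by simpa using hw2⟩, rfl⟩

section comm_alg

lemma euler_vanish {A : Type*} [CommRing A] [IsDomain A] [IsNoetherianRing A] [Algebra k A]
    {J : Type*} [Fintype J] [DecidableEq J] (ξ : J → A) (D : J → Derivation k A A)
    (F m : Ideal A) (hm : m.IsMaximal) (hDF : ∀ j, ∀ f ∈ F, D j f ∈ F)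
    (hFI : F ≤ Ideal.span (Set.range ξ)) (hIm : Ideal.span (Set.range ξ) ≤ m)
    (hδ : (Matrix.of fun i j ↦ D i (ξ j)).det ∉ m) : F = ⊥ := by
  set I := Ideal.span (Set.range ξ) with hI
  set M : Matrix J J A := Matrix.of fun i j ↦ D i (ξ j) with hM
  set δ := M.det with hδd
  let D' : J → Derivation k A A := fun j ↦ ∑ i, M.adjugate j i • D i
  have hD'ap : ∀ j f, D' j f = ∑ i, M.adjugate j i * D i f := by
    intro j f
    simp only [D']
    rw [← Derivation.coeFnAddMonoidHom_apply, map_sum, Finset.sum_apply]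
    rfl
  have hD'F : ∀ j, ∀ f ∈ F, D' j f ∈ F := by
    intro j f hf
    rw [hD'ap]
    exact Ideal.sum_mem _ fun i _ ↦ F.mul_mem_left _ (hDF i f hf)
  have hD'ξ : ∀ j l, D' j (ξ l) = if j = l then δ else 0 := by
    intro j l
    have := congrFun (congrFun (Matrix.adjugate_mul M) j) l
    rw [Matrix.mul_apply] at this
    rw [hD'ap]
    simp only [hM, Matrix.of_apply] at this ⊢
    rw [this, Matrix.smul_apply, Matrix.one_apply]
    split_ifs <;> simp [hδd, hM]
  let E : Derivation k A A := ∑ j, ξ j • D' j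
  have hEap : ∀ f, E f = ∑ j, ξ j * D' j f := by
    intro f
    simp only [E]
    rw [← Derivation.coeFnAddMonoidHom_apply, map_sum, Finset.sum_apply]
    rfl
  have hξI : ∀ j, ξ j ∈ I := fun j ↦ Ideal.subset_span ⟨j, rfl⟩
  have hEI : ∀ f, E f ∈ I := fun f ↦ by
    rw [hEap]; exact Ideal.sum_mem _ fun j _ ↦ I.mul_mem_right _ (hξI j)
  have h1 : ∀ h ∈ I, E h - δ * h ∈ I ^ 2 := by
    intro h hh
    refine Submodule.span_induction (p := fun h _ ↦ E h - δ * h ∈ I ^ 2) ?_ ?_ ?_ ?_ hh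
    · rintro _ ⟨l, rfl⟩
      rw [hEap]
      simp [hD'ξ, mul_comm]
    · simp
    · intro x y _ _ hx hy
      have : E (x + y) - δ * (x + y) = (E x - δ * x) + (E y - δ * y) := by rw [map_add]; ring
      rw [this]; exact add_mem hx hy
    · intro a x hx' hx
      have hxI : x ∈ I := hx'
      have : E (a • x) - δ * (a • x) = a * (E x - δ * x) + x * E a := by
        rw [smul_eq_mul, Derivation.leibniz, smul_eq_mul, smul_eq_mul]; ring
      rw [this]
      refine add_mem (Ideal.mul_mem_left _ _ hx) ?_
      rw [pow_two]; exact Ideal.mul_mem_mul hxI (hEI a)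
  have h2 : ∀ n : ℕ, ∀ f ∈ I ^ n, E f - n * δ * f ∈ I ^ (n + 1) := by
    intro n
    induction n with
    | zero => intro f _; simpa using hEI f
    | succ n ih =>
      intro f hf
      rw [pow_succ] at hf
      refine Submodule.mul_induction_on hf ?_ ?_
      · intro a ha h hh
        have : E (a * h) - ((n + 1 : ℕ) : A) * δ * (a * h) =
            a * (E h - δ * h) + (E a - n * δ * a) * h := by
          rw [Derivation.leibniz, smul_eq_mul, smul_eq_mul]; push_cast; ring
        rw [this]
        refine add_mem ?_ ?_
        · have := Ideal.mul_mem_mul ha (h1 h hh)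
          rwa [← pow_add] at this
        · have := Ideal.mul_mem_mul (ih a ha) hh
          rwa [← pow_succ] at this
      · intro x y hx hy
        have : E (x + y) - ((n + 1 : ℕ) : A) * δ * (x + y) =
          (E x - ((n + 1 : ℕ) : A) * δ * x) + (E y - ((n + 1 : ℕ) : A) * δ * y) := by
            rw [map_add]; ring
        rw [this]; exact add_mem hx hy
  have h3 : ∀ n : ℕ, ∃ N : ℕ, ∀ f ∈ F, δ ^ N * f ∈ I ^ (n + 1) := by
    intro n
    induction n with
    | zero => exact ⟨0, fun f hf ↦ by simpa using hFI hf⟩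
    | succ n ih =>
      obtain ⟨N, hN⟩ := ih
      refine ⟨N + 1 + N, fun f hf ↦ ?_⟩
      have hg := hN f hf
      have hgF : δ ^ N * f ∈ F := F.mul_mem_left _ hf
      set q := δ ^ N * f with hq
      have e1 : δ ^ N * E q ∈ I ^ (n + 2) := by
        rw [hEap, Finset.mul_sum]
        refine Ideal.sum_mem _ fun j _ ↦ ?_
        have := Ideal.mul_mem_mul (hN _ (hD'F j q hgF)) (hξI j)
        rw [← pow_succ] at this
        convert this using 1; ring
      have e2 := Ideal.mul_mem_left _ (δ ^ N) (h2 (n + 1) q hg)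
      have e3 : ((n + 1 : ℕ) : A) * (δ ^ (N + 1) * q) ∈ I ^ (n + 2) := by
        have := sub_mem e1 e2
        convert this using 1; ring
      have e4 : δ ^ (N + 1 + N) * f = algebraMap k A ((n + 1 : ℕ) : k)⁻¹ *
          (((n + 1 : ℕ) : A) * (δ ^ (N + 1) * q)) := by
        rw [← mul_assoc, ← map_natCast (algebraMap k A), ← map_mul, inv_mul_cancel₀
          (by exact_mod_cast Nat.succ_ne_zero n), map_one, hq]
        ring
      rw [e4]
      exact Ideal.mul_mem_left _ _ e3
  rw [eq_bot_iff]
  intro f hf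
  rw [← Ideal.iInf_pow_eq_bot_of_isDomain m hm.ne_top, Ideal.mem_iInf]
  intro n
  obtain ⟨N, hN⟩ := h3 n
  have hf1 : δ ^ N * f ∈ m ^ n :=
    Ideal.pow_le_pow_right (Nat.le_succ n) (Ideal.pow_right_mono hIm _ (hN f hf))
  obtain ⟨a, b, hb, hab⟩ := hm.exists_inv hδ
  have hcop : IsCoprime δ b := ⟨a, 1, by rw [one_mul]; exact hab⟩
  obtain ⟨u, v, huv⟩ := hcop.pow (m := N) (n := n)
  have : f = u * (δ ^ N * f) + (v * f) * b ^ n := by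
    linear_combination (-f) * huv
  rw [this]
  exact add_mem (Ideal.mul_mem_left _ _ hf1) (Ideal.mul_mem_left _ _ (Ideal.pow_mem_pow hb n))

end comm_alg

section tens

open TensorProduct

/-- the transporter ideal -/
noncomputable def trIdeal (A : Type*) [CommRing A] [Algebra k A] (Gb Gc : Submodule k g)
    (X : A ⊗[k] g) : Ideal A where
  carrier := {f | ∀ v ∈ Gc, f ⊗ₜ[k] v ∈ Submodule.map (ad A (A ⊗[k] g) X) (Gb.baseChange A)}
  add_mem' := by
    intro a b ha hb v hv
    rw [TensorProduct.add_tmul]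
    exact add_mem (ha v hv) (hb v hv)
  zero_mem' := by
    intro v hv
    rw [TensorProduct.zero_tmul]
    exact zero_mem _
  smul_mem' := by
    intro r f hf v hv
    rw [← TensorProduct.smul_tmul']
    exact Submodule.smul_mem _ _ (hf v hv)

lemma mem_trIdeal {A : Type*} [CommRing A] [Algebra k A] {Gb Gc : Submodule k g}
    {X : A ⊗[k] g} {f : A} : f ∈ trIdeal k g A Gb Gc X ↔
      ∀ v ∈ Gc, ∃ w ∈ Gb.baseChange A, ⁅X, w⁆ = f ⊗ₜ[k] v := Iff.rfl

lemma rTensor_deriv_lie {A : Type*} [CommRing A] [Algebra k A] (D : Derivation k A A)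
    (a b : A ⊗[k] g) : LinearMap.rTensor g (D : A →ₗ[k] A) ⁅a, b⁆ =
      ⁅LinearMap.rTensor g (D : A →ₗ[k] A) a, b⁆ + ⁅a, LinearMap.rTensor g (D : A →ₗ[k] A) b⁆ := by
  induction a with
  | zero => simp
  | add x y hx hy => rw [add_lie, map_add, hx, hy, map_add, add_lie, add_lie]; abel
  | tmul f x =>
    induction b with
    | zero => simp
    | add u v hu hv => rw [lie_add, map_add, hu, hv, map_add, lie_add, lie_add]; abel
    | tmul h y =>
      simp only [LieAlgebra.ExtendScalars.bracket_tmul, LinearMap.rTensor_tmul,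
        Derivation.coeFn_coe, Derivation.leibniz, smul_eq_mul]
      rw [← TensorProduct.add_tmul]
      congr 1; ring

lemma trIdeal_stable {A : Type*} [CommRing A] [Algebra k A] (Gb Gc : Submodule k g)
    (X : A ⊗[k] g) (D : Derivation k A A) (z : g)
    (hX : LinearMap.rTensor g (D : A →ₗ[k] A) X = ⁅(1 : A) ⊗ₜ[k] z, X⁆)
    (hb : ∀ w ∈ Gb, ⁅z, w⁆ ∈ Gb) (hc : ∀ w ∈ Gc, ⁅z, w⁆ ∈ Gc)
    (f : A) (hf : f ∈ trIdeal k g A Gb Gc X) : D f ∈ trIdeal k g A Gb Gc X := by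
  rw [mem_trIdeal] at hf ⊢
  intro v hv
  obtain ⟨w, hw, hwe⟩ := hf v hv
  obtain ⟨w', hw', hwe'⟩ := hf _ (hc v hv)
  have hDw : ∀ w ∈ Gb.baseChange A, LinearMap.rTensor g (D : A →ₗ[k] A) w ∈ Gb.baseChange A := by
    intro w hw
    rw [Submodule.baseChange_eq_span] at hw
    refine Submodule.span_induction (p := fun w _ ↦
      LinearMap.rTensor g (D : A →ₗ[k] A) w ∈ Gb.baseChange A) ?_ ?_ ?_ ?_ hw
    · rintro _ ⟨x, hx, rfl⟩
      simp
    · simp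
    · intro x y _ _ hx hy; rw [map_add]; exact add_mem hx hy
    · intro a x hx' hx
      have key : ∀ x : A ⊗[k] g, LinearMap.rTensor g (D : A →ₗ[k] A) (a • x) =
          a • LinearMap.rTensor g (D : A →ₗ[k] A) x + D a • x := by
        intro x
        induction x with
        | zero => simp
        | add x y hx hy => rw [smul_add, map_add, hx, hy, map_add, smul_add, smul_add]; abel
        | tmul h y =>
          simp only [TensorProduct.smul_tmul', LinearMap.rTensor_tmul, Derivation.coeFn_coe,
            Derivation.leibniz, smul_eq_mul]
          rw [← TensorProduct.add_tmul]
          congr 1; ring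
      rw [key]
      refine add_mem (Submodule.smul_mem _ _ hx) (Submodule.smul_mem _ _ ?_)
      rw [Submodule.baseChange_eq_span]; exact hx'
  have hzw : ∀ w ∈ Gb.baseChange A, ⁅(1 : A) ⊗ₜ[k] z, w⁆ ∈ Gb.baseChange A := by
    intro w hw
    rw [Submodule.baseChange_eq_span] at hw
    refine Submodule.span_induction (p := fun w _ ↦
      ⁅(1 : A) ⊗ₜ[k] z, w⁆ ∈ Gb.baseChange A) ?_ ?_ ?_ ?_ hw
    · rintro _ ⟨x, hx, rfl⟩
      simp only [TensorProduct.mk_apply, LieAlgebra.ExtendScalars.bracket_tmul, one_mul]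
      exact Submodule.tmul_mem_baseChange_of_mem _ (hb x hx)
    · simp
    · intro x y _ _ hx hy; rw [lie_add]; exact add_mem hx hy
    · intro a x hx' hx
      rw [lie_smul]
      exact Submodule.smul_mem _ _ hx
  have e := congrArg (LinearMap.rTensor g (D : A →ₗ[k] A)) hwe
  rw [rTensor_deriv_lie, hX, LinearMap.rTensor_tmul, Derivation.coeFn_coe] at e
  have e2 := congrArg (fun t ↦ ⁅(1 : A) ⊗ₜ[k] z, t⁆) hwe
  simp only [LieAlgebra.ExtendScalars.bracket_tmul, one_mul] at e2
  rw [leibniz_lie] at e2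
  refine ⟨LinearMap.rTensor g (D : A →ₗ[k] A) w - ⁅(1 : A) ⊗ₜ[k] z, w⁆ + w',
    add_mem (sub_mem (hDw w hw) (hzw w hw)) hw', ?_⟩
  rw [lie_add, lie_sub, hwe', ← e, ← e2]
  abel

end tens

section poly

open TensorProduct

/-- evaluation at a point -/
noncomputable def evT {A : Type*} [CommRing A] [Algebra k A] (φ : A →ₐ[k] k) : A ⊗[k] g →ₗ[k] g :=
  (TensorProduct.lid k g).toLinearMap ∘ₗ LinearMap.rTensor g φ.toLinearMap

lemma evT_tmul {A : Type*} [CommRing A] [Algebra k A] (p : A →ₐ[k] k) (f : A) (x : g) :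
    evT k g p (f ⊗ₜ[k] x) = p f • x := by
  simp [evT]

lemma evT_lie {A : Type*} [CommRing A] [Algebra k A] (p : A →ₐ[k] k) (a b : A ⊗[k] g) :
    evT k g p ⁅a, b⁆ = ⁅evT k g p a, evT k g p b⁆ := by
  induction a with
  | zero => simp
  | add x y hx hy => rw [add_lie, map_add, hx, hy, map_add, add_lie]
  | tmul f x =>
    induction b with
    | zero => simp
    | add u v hu hv => rw [lie_add, map_add, hu, hv, map_add, lie_add]
    | tmul h y =>
      simp only [LieAlgebra.ExtendScalars.bracket_tmul, evT_tmul, map_mul, smul_lie, lie_smul,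
        smul_smul]
      rw [mul_comm]

lemma evT_mem {A : Type*} [CommRing A] [Algebra k A] (p : A →ₐ[k] k) (G : Submodule k g)
    (a : A ⊗[k] g) (ha : a ∈ G.baseChange A) : evT k g p a ∈ G := by
  rw [Submodule.baseChange_eq_span] at ha
  have key : ∀ (f : A) (x : A ⊗[k] g), evT k g p (f • x) = p f • evT k g p x := by
    intro f x
    induction x with
    | zero => simp
    | add x y hx hy => rw [smul_add, map_add, hx, hy, map_add, smul_add]
    | tmul h y => rw [TensorProduct.smul_tmul', evT_tmul, evT_tmul, smul_eq_mul, map_mul, smul_smul]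
  refine Submodule.span_induction (p := fun w _ ↦ evT k g p w ∈ G) ?_ ?_ ?_ ?_ ha
  · rintro _ ⟨x, hx, rfl⟩
    rw [TensorProduct.mk_apply, evT_tmul]
    exact G.smul_mem _ hx
  · simp
  · intro x y _ _ hx hy; rw [map_add]; exact add_mem hx hy
  · intro f x _ hx
    rw [key]; exact G.smul_mem _ hx

lemma trIdeal_ne_bot {A : Type*} [CommRing A] [Algebra k A] {ι : Type*} [Fintype ι] (ξ : ι → A)
    (hev : ∀ p : ι → k, ∃ φ : A →ₐ[k] k, ∀ i, φ (ξ i) = p i) (Ga Gb Gc : Submodule k g) (e : Basis ι k Ga)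
    (x₀ : g) (hx₀ : x₀ ∈ Ga) (hsurj : ∀ v ∈ Gc, ∃ w ∈ Gb, ⁅x₀, w⁆ = v)
    (hab : ∀ a ∈ Ga, ∀ b ∈ Gb, ⁅a, b⁆ ∈ Gc) :
    trIdeal k g A Gb Gc (∑ i, ξ i ⊗ₜ[k] (e i : g)) ≠ ⊥ := by
  classical
  set X : A ⊗[k] g := ∑ i, ξ i ⊗ₜ[k] (e i : g) with hX
  let b := Module.finBasis k Gc
  choose w hw hwe using fun j ↦ hsurj (b j) (b j).2
  let P : Matrix (Fin (finrank k Gc)) (Fin (finrank k Gc)) A :=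
    Matrix.of fun l j ↦ ∑ i, ξ i *
      algebraMap k A (b.repr ⟨⁅(e i : g), w j⁆, hab _ (e i).2 _ (hw j)⟩ l)
  have hXw : ∀ j, ⁅X, (1 : A) ⊗ₜ[k] w j⁆ = ∑ l, P l j ⊗ₜ[k] (b l : g) := by
    intro j
    rw [hX, sum_lie]
    simp only [LieAlgebra.ExtendScalars.bracket_tmul, mul_one, P, Matrix.of_apply,
      TensorProduct.sum_tmul]
    rw [Finset.sum_comm]
    refine Finset.sum_congr rfl fun i _ ↦ ?_
    have h1 := congrArg Subtype.val
      (b.sum_repr ⟨⁅(e i : g), w j⁆, hab _ (e i).2 _ (hw j)⟩)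
    simp only [AddSubmonoidClass.coe_finsetSum, Submodule.coe_smul] at h1
    conv_lhs => rw [← h1]
    rw [TensorProduct.tmul_sum]
    refine Finset.sum_congr rfl fun l _ ↦ ?_
    rw [TensorProduct.tmul_smul, TensorProduct.smul_tmul', mul_comm, Algebra.smul_def]
  have hdet : P.det ∈ trIdeal k g A Gb Gc X := by
    have hbm : ∀ m, P.det ⊗ₜ[k] (b m : g) ∈ Submodule.map
        (ad A (A ⊗[k] g) X) (Gb.baseChange A) := by
      intro m
      refine ⟨∑ j, P.adjugate j m • ((1 : A) ⊗ₜ[k] w j),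
        Submodule.sum_mem _ fun j _ ↦ Submodule.smul_mem _ _
          (Submodule.tmul_mem_baseChange_of_mem _ (hw j)), ?_⟩
      rw [ad_apply, lie_sum]
      simp only [lie_smul, hXw]
      simp only [Finset.smul_sum, TensorProduct.smul_tmul', smul_eq_mul]
      rw [Finset.sum_comm]
      simp only [← TensorProduct.sum_tmul]
      have := fun l ↦ congrFun (congrFun (Matrix.mul_adjugate P) l) m
      simp only [Matrix.mul_apply, Matrix.smul_apply, Matrix.one_apply] at this
      simp only [mul_comm (P.adjugate _ _), this]
      rw [Finset.sum_eq_single m]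
      · simp
      · intro l _ hl; simp [hl]
      · simp
    intro v hv
    have h1 := congrArg Subtype.val (b.sum_repr ⟨v, hv⟩)
    simp only [AddSubmonoidClass.coe_finsetSum, Submodule.coe_smul] at h1
    rw [← h1, TensorProduct.tmul_sum]
    refine Submodule.sum_mem _ fun l _ ↦ ?_
    rw [TensorProduct.tmul_smul]
    exact Submodule.smul_of_tower_mem _ _ (hbm l)
  intro hbot
  rw [hbot, Ideal.mem_bot] at hdet
  let p : ι → k := fun i ↦ e.repr ⟨x₀, hx₀⟩ i
  obtain ⟨φ, hφ⟩ := hev p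
  have h2 := congrArg φ hdet
  rw [AlgHom.map_det, map_zero] at h2
  have h3 : φ.mapMatrix P = 1 := by
    ext l j
    simp only [AlgHom.mapMatrix_apply, Matrix.map_apply, P, Matrix.of_apply, map_sum, map_mul,
      hφ, AlgHom.commutes, Algebra.algebraMap_self, RingHom.id_apply]
    have h4 : (b j) = ∑ i, p i • (⟨⁅(e i : g), w j⁆, hab _ (e i).2 _ (hw j)⟩ : Gc) := by
      apply Subtype.ext
      simp only [AddSubmonoidClass.coe_finsetSum, Submodule.coe_smul]
      rw [← hwe j]
      have h1 := congrArg Subtype.val (e.sum_repr ⟨x₀, hx₀⟩)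
      simp only [AddSubmonoidClass.coe_finsetSum, Submodule.coe_smul] at h1
      conv_lhs => rw [← h1]
      rw [sum_lie]
      simp only [smul_lie, p]
    have h5 := congrArg (fun t ↦ b.repr t l) h4
    simp only [map_sum, map_smul, Finsupp.coe_finsetSum, Finset.sum_apply, Finsupp.smul_apply,
      Basis.repr_self, smul_eq_mul] at h5
    rw [← h5, Finsupp.single_apply, Matrix.one_apply]
    simp [eq_comm]
  rw [h3, Matrix.det_one] at h2
  exact one_ne_zero h2

lemma forward_poly {A : Type*} [CommRing A] [IsDomain A] [IsNoetherianRing A] [Algebra k A] {I J : Type*} [Fintype I] [Fintype J] (ξ : I ⊕ J → A)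
    (hev : ∀ p : I ⊕ J → k, ∃ φ : A →ₐ[k] k, ∀ i, φ (ξ i) = p i)
    (hder : ∀ d : I ⊕ J → A, ∃ D : Derivation k A A, ∀ i, D (ξ i) = d i)
    (hvan : ∀ f : A, (∀ φ : A →ₐ[k] k, (∀ j, φ (ξ (Sum.inr j)) = 0) → φ f = 0) →
      f ∈ Ideal.span (Set.range fun j : J ↦ ξ (Sum.inr j)))
    (Ga Gb Gc : Submodule k g)
    (e : Basis (I ⊕ J) k Ga)
    (x₀ : g) (hx₀ : x₀ ∈ Ga) (hsurj : ∀ v ∈ Gc, ∃ w ∈ Gb, ⁅x₀, w⁆ = v)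
    (hab : ∀ a ∈ Ga, ∀ b ∈ Gb, ⁅a, b⁆ ∈ Gc) (y : g) (hy : y ∈ Ga)
    (hyJ : ∀ j, e.repr ⟨y, hy⟩ (Sum.inr j) = 0) (z : J → g)
    (hza : ∀ j, ∀ a ∈ Ga, ⁅z j, a⁆ ∈ Ga) (hzb : ∀ j, ∀ a ∈ Gb, ⁅z j, a⁆ ∈ Gb)
    (hzc : ∀ j, ∀ a ∈ Gc, ⁅z j, a⁆ ∈ Gc) (hzy : ∀ j, (e (Sum.inr j) : g) = ⁅z j, y⁆)
    (v₀ : g) (hv₀ : v₀ ∈ Gc)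
    (hv : ∀ a : Ga, (∀ j, e.repr a (Sum.inr j) = 0) → ∀ w ∈ Gb, ∀ t : k,
      ⁅(a : g), w⁆ = t • v₀ → t = 0) : False := by
  classical
  set X : A ⊗[k] g := ∑ i, ξ i ⊗ₜ[k] (e i : g) with hX
  have hne := trIdeal_ne_bot k g ξ hev Ga Gb Gc e x₀ hx₀ hsurj hab
  rw [← hX] at hne
  apply hne
  let cf : J → I ⊕ J → I ⊕ J → k := fun j i l ↦ e.repr ⟨⁅z j, (e l : g)⁆, hza j _ (e l).2⟩ i
  choose D hDX using fun j ↦ hder (fun i ↦ ∑ l, cf j i l • ξ l)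
  let p : I ⊕ J → k := fun i ↦ e.repr ⟨y, hy⟩ i
  obtain ⟨φ, hφ⟩ := hev p
  refine euler_vanish k (fun j : J ↦ ξ (Sum.inr j)) D _ (RingHom.ker φ) ?_ ?_ ?_ ?_ ?_
  · exact RingHom.ker_isMaximal_of_surjective _ fun c ↦ ⟨algebraMap k A c, by simp⟩
  · intro j f hf
    refine trIdeal_stable k g Gb Gc X (D j) (z j) ?_ (hzb j) (hzc j) f hf
    rw [hX, map_sum, lie_sum]
    simp only [LieAlgebra.ExtendScalars.bracket_tmul, one_mul, LinearMap.rTensor_tmul,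
      Derivation.coeFn_coe, hDX, TensorProduct.sum_tmul]
    rw [Finset.sum_comm]
    refine Finset.sum_congr rfl fun l _ ↦ ?_
    have h1 := congrArg Subtype.val (e.sum_repr ⟨⁅z j, (e l : g)⁆, hza j _ (e l).2⟩)
    simp only [AddSubmonoidClass.coe_finsetSum, Submodule.coe_smul] at h1
    conv_rhs => rw [← h1]
    rw [TensorProduct.tmul_sum]
    refine Finset.sum_congr rfl fun i _ ↦ ?_
    rw [TensorProduct.tmul_smul, TensorProduct.smul_tmul']
  · intro f hf
    refine hvan f fun ψ hψ ↦ ?_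
    obtain ⟨w, hw, hwe⟩ := (mem_trIdeal k g).mp hf v₀ hv₀
    have h3 := congrArg (evT k g ψ) hwe
    rw [evT_lie, evT_tmul, hX, map_sum] at h3
    simp only [evT_tmul] at h3
    refine hv (∑ i, ψ (ξ i) • e i) ?_ _ (evT_mem k g ψ Gb w hw) _ ?_
    · intro j
      rw [e.repr_sum_self]
      exact hψ j
    · rw [← h3]
      simp only [AddSubmonoidClass.coe_finsetSum, Submodule.coe_smul]
  · rw [Ideal.span_le]
    rintro _ ⟨j, rfl⟩
    simp only [SetLike.mem_coe, RingHom.mem_ker, hφ, p]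
    exact hyJ j
  · rw [RingHom.mem_ker, AlgHom.map_det]
    have h3 : φ.mapMatrix (Matrix.of fun i j ↦ D i
        (ξ (Sum.inr j))) = 1 := by
      ext i j
      simp only [AlgHom.mapMatrix_apply, Matrix.map_apply, Matrix.of_apply, hDX, map_sum,
        map_smul, smul_eq_mul, hφ]
      have h4 : e (Sum.inr i) = ∑ l, p l • (⟨⁅z i, (e l : g)⁆, hza i _ (e l).2⟩ : Ga) := by
        apply Subtype.ext
        simp only [AddSubmonoidClass.coe_finsetSum, Submodule.coe_smul]
        rw [hzy]
        have h1 := congrArg Subtype.val (e.sum_repr ⟨y, hy⟩)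
        simp only [AddSubmonoidClass.coe_finsetSum, Submodule.coe_smul] at h1
        conv_lhs => rw [← h1]
        rw [lie_sum]
        simp only [lie_smul, p]
      have h5 := congrArg (fun t ↦ e.repr t (Sum.inr j)) h4
      simp only [map_sum, map_smul, Finsupp.coe_finsetSum, Finset.sum_apply, Finsupp.smul_apply,
        Basis.repr_self, smul_eq_mul] at h5
      simp only [cf, mul_comm _ (p _)]
      rw [← h5, Finsupp.single_apply, Matrix.one_apply]
      simp
    rw [h3, Matrix.det_one]
    exact one_ne_zero

end poly

lemma mv_vanish {I J : Type*} (f : MvPolynomial (I ⊕ J) k)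
    (hf : ∀ φ : MvPolynomial (I ⊕ J) k →ₐ[k] k,
      (∀ j, φ (MvPolynomial.X (Sum.inr j)) = 0) → φ f = 0) :
    f ∈ Ideal.span (Set.range fun j : J ↦ (MvPolynomial.X (Sum.inr j) : MvPolynomial (I ⊕ J) k)) := by
  let φ : MvPolynomial (I ⊕ J) k →ₐ[k] MvPolynomial (I ⊕ J) k :=
    MvPolynomial.aeval (Sum.elim (fun i ↦ MvPolynomial.X (Sum.inl i)) (fun _ ↦ 0))
  have h1 : φ f = 0 := by
    apply MvPolynomial.funext
    intro r
    rw [map_zero]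
    have h2 := hf ((MvPolynomial.aeval r).comp φ) (fun j ↦ by simp [φ])
    rw [AlgHom.comp_apply] at h2
    rw [← h2, MvPolynomial.aeval_eq_eval]
  have h2 : (Ideal.Quotient.mkₐ k (Ideal.span (Set.range fun j : J ↦
      (MvPolynomial.X (Sum.inr j) : MvPolynomial (I ⊕ J) k)))).comp φ =
      Ideal.Quotient.mkₐ k _ := by
    apply MvPolynomial.algHom_ext
    rintro (i | j)
    · simp only [AlgHom.comp_apply, φ, MvPolynomial.aeval_X, Sum.elim_inl]
    · simp only [AlgHom.comp_apply, φ, MvPolynomial.aeval_X, Sum.elim_inr, map_zero]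
      symm
      exact Ideal.Quotient.eq_zero_iff_mem.mpr (Ideal.subset_span ⟨j, rfl⟩)
  have h3 := AlgHom.congr_fun h2 f
  rw [AlgHom.comp_apply, h1, map_zero] at h3
  exact Ideal.Quotient.eq_zero_iff_mem.mp h3.symm

lemma ss_ker_range (y : g) (hy : IsSSElt k g y) (w : g) (h : ⁅y, ⁅y, w⁆⁆ = 0) : ⁅y, w⁆ = 0 := by
  have := (isCompl_of_ss k (ad k g y) hy).disjoint
  exact Submodule.disjoint_def.mp this _ (by simpa using h) ⟨w, rfl⟩

lemma no_centralizer (θ η : g ≃ₗ⁅k⁆ g) (hθθ : ∀ x, θ (θ x) = x) (hηη : ∀ x, η (η x) = x)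
    (hθη : ∀ x, θ (η x) = η (θ x)) (Ga Gb Gc : Submodule k g)
    (ha : ∀ x, x ∈ Ga ↔ θ x = -x ∧ η x = x) (hb : ∀ x, x ∈ Gb ↔ θ x = x ∧ η x = -x)
    (hc : ∀ x, x ∈ Gc ↔ θ x = -x ∧ η x = -x)
    (x₀ : g) (hx₀ : x₀ ∈ Ga) (hmap : Submodule.map (ad k g x₀) Gb = Gc)
    (cs : Submodule k g) (hcs : IsCartanSubspace k g Ga cs) (v₀ : g) (hv₀ : v₀ ∈ Gc)
    (hcv : ∀ e ∈ cs, ⁅e, v₀⁆ = 0) : v₀ = 0 := by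
  by_contra hne
  obtain ⟨y, hy, hgen⟩ := exists_generic_s18 k g cs hcs.2.1 hcs.2.2.1
  have hya := (ha y).mp (hcs.1 hy)
  let G0 : Submodule k g :=
    { carrier := {x | θ x = x ∧ η x = x}
      add_mem' := by
        rintro a b ⟨h1, h2⟩ ⟨h3, h4⟩
        exact ⟨by rw [map_add, h1, h3], by rw [map_add, h2, h4]⟩
      zero_mem' := ⟨map_zero _, map_zero _⟩
      smul_mem' := by
        rintro t a ⟨h1, h2⟩
        exact ⟨by rw [map_smul, h1], by rw [map_smul, h2]⟩ }
  have hG0 : ∀ x, x ∈ G0 ↔ θ x = x ∧ η x = x := fun _ ↦ Iff.rfl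
  let p : Submodule k Ga := cs.comap Ga.subtype
  let R : Submodule k Ga := (G0.map (ad k g y)).comap Ga.subtype
  have hcompl : IsCompl p R := by
    constructor
    · rw [Submodule.disjoint_def]
      rintro ⟨x, hxa⟩ hxp ⟨w, hw, hwe⟩
      have hx1 : x ∈ cs := hxp
      have hx2 : ⁅y, w⁆ = x := hwe
      apply Subtype.ext
      show x = 0
      rw [← hx2]
      apply ss_ker_range k g y (hcs.2.1 y hy)
      rw [hx2]
      exact hcs.2.2.1 y hy x hx1
    · rw [codisjoint_iff, eq_top_iff]
      rintro ⟨x, hxa⟩ -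
      obtain ⟨h1, h2⟩ := (ha x).mp hxa
      obtain ⟨u, w, hxe, hu, hu1, hu2, hw1, hw2⟩ := ss_decomp k g θ η hθθ hηη hθη y
        (hcs.2.1 y hy) hya.1 hya.2 x (-1) 1 (Or.inr rfl) (Or.inl rfl)
        (by simpa using h1) (by simpa using h2)
      have hua : u ∈ Ga := (ha u).mpr ⟨by simpa using hu1, by simpa using hu2⟩
      have huc : u ∈ cs := cartan_centralizer k g θ η hθθ hηη hθη Ga cs ha hcs u hua (hgen u hu)
      have hw0 : w ∈ G0 := ⟨by simpa using hw1, by simpa using hw2⟩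
      have hra : ⁅y, w⁆ ∈ Ga := by
        have : ⁅y, w⁆ = x - u := by rw [hxe]; abel
        rw [this]; exact sub_mem hxa hua
      rw [Submodule.mem_sup]
      exact ⟨⟨u, hua⟩, huc, ⟨⁅y, w⁆, hra⟩, ⟨w, hw0, rfl⟩, Subtype.ext hxe.symm⟩
  let e := ((Module.finBasis k p).prod (Module.finBasis k R)).map
    (Submodule.prodEquivOfIsCompl p R hcompl)
  have hel : ∀ i, e (Sum.inl i) ∈ p := by
    intro i; simp [e]
  have her : ∀ j, e (Sum.inr j) ∈ R := by
    intro i; simp [e]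
  choose z hz hze using her
  have hab : ∀ a ∈ Ga, ∀ b ∈ Gb, ⁅a, b⁆ ∈ Gc := by
    intro a haa b hbb
    obtain ⟨a1, a2⟩ := (ha a).mp haa
    obtain ⟨b1, b2⟩ := (hb b).mp hbb
    rw [hc, LieEquiv.map_lie, LieEquiv.map_lie, a1, a2, b1, b2]; simp
  have hz0 : ∀ j, θ (-z j) = -z j ∧ η (-z j) = -z j := fun j ↦ (hG0 _).mp (neg_mem (hz j))
  refine forward_poly k g (A := MvPolynomial (Fin (finrank k p) ⊕ Fin (finrank k R)) k)
    MvPolynomial.X (fun p ↦ ⟨MvPolynomial.aeval p, fun i ↦ by simp⟩)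
    (fun d ↦ ⟨MvPolynomial.mkDerivation k d, fun i ↦ MvPolynomial.mkDerivation_X _ _ _⟩)
    (mv_vanish k) Ga Gb Gc e x₀ hx₀ ?_ hab y (hcs.1 hy) ?_ (fun j ↦ -z j) ?_ ?_ ?_ ?_ v₀ hv₀ ?_
  · intro v hv
    rw [← hmap] at hv
    obtain ⟨w, hw, hwe⟩ := hv
    exact ⟨w, hw, hwe⟩
  · intro j
    have : (Submodule.prodEquivOfIsCompl p R hcompl).symm ⟨y, hcs.1 hy⟩ =
        (⟨⟨y, hcs.1 hy⟩, hy⟩, 0) :=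
      Submodule.prodEquivOfIsCompl_symm_apply_left p R hcompl ⟨⟨y, hcs.1 hy⟩, hy⟩
    simp only [e, Basis.map_repr, LinearEquiv.trans_apply, this]
    simp
  · intro j a haa
    obtain ⟨a1, a2⟩ := (ha a).mp haa
    rw [ha, LieEquiv.map_lie, LieEquiv.map_lie, a1, a2, (hz0 j).1, (hz0 j).2]; simp
  · intro j a haa
    obtain ⟨a1, a2⟩ := (hb a).mp haa
    rw [hb, LieEquiv.map_lie, LieEquiv.map_lie, a1, a2, (hz0 j).1, (hz0 j).2]; simp
  · intro j a haa
    obtain ⟨a1, a2⟩ := (hc a).mp haa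
    rw [hc, LieEquiv.map_lie, LieEquiv.map_lie, a1, a2, (hz0 j).1, (hz0 j).2]; simp
  · intro j
    have : ⁅y, z j⁆ = (e (Sum.inr j) : g) := hze j
    rw [← this, neg_lie, lie_skew]
  · intro a haJ w hw t ht
    have hap : a ∈ p := by
      rw [← e.sum_repr a, Fintype.sum_sum_type]
      refine add_mem (Submodule.sum_mem _ fun i _ ↦ p.smul_mem _ (hel i)) ?_
      refine Submodule.sum_mem _ fun j _ ↦ ?_
      rw [haJ j, zero_smul]; exact zero_mem _
    have hac : (a : g) ∈ cs := hap
    have h1 := ss_ker_range k g a (hcs.2.1 _ hac) w (by rw [ht, lie_smul, hcv _ hac, smul_zero])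
    rw [ht] at h1
    exact (smul_eq_zero.mp h1).resolve_right hne

lemma core_forward (θ η : g ≃ₗ⁅k⁆ g) (hθθ : ∀ x, θ (θ x) = x) (hηη : ∀ x, η (η x) = x)
    (hθη : ∀ x, θ (η x) = η (θ x)) (Ga Gb Gc : Submodule k g)
    (ha : ∀ x, x ∈ Ga ↔ θ x = -x ∧ η x = x) (hb : ∀ x, x ∈ Gb ↔ θ x = x ∧ η x = -x)
    (hc : ∀ x, x ∈ Gc ↔ θ x = -x ∧ η x = -x)
    (h : ∃ x ∈ Ga, Submodule.map (ad k g x) Gb = Gc) (cs : Submodule k g)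
    (hcs : IsCartanSubspace k g Ga cs) : IsCartanSubspace k g (Ga ⊔ Gc) cs := by
  obtain ⟨x₀, hx₀, hmap⟩ := h
  refine ⟨hcs.1.trans le_sup_left, hcs.2.1, hcs.2.2.1, fun c' h1 h2 h3 h4 ↦ ?_⟩
  refine hcs.2.2.2 c' (fun x hx ↦ ?_) h2 h3 h4
  obtain ⟨a, haa, b, hbb, rfl⟩ := Submodule.mem_sup.mp (h1 hx)
  have hb0 : b = 0 := by
    refine no_centralizer k g θ η hθθ hηη hθη Ga Gb Gc ha hb hc x₀ hx₀ hmap cs hcs b hbb ?_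
    intro e he
    have e1 := h3 e (h4 he) _ hx
    have e2 := congrArg η e1
    rw [LieEquiv.map_lie, map_add, map_zero, ((ha e).mp (hcs.1 he)).2, ((ha a).mp haa).2,
      ((hc b).mp hbb).2, lie_add, lie_neg] at e2
    rw [lie_add] at e1
    have e3 : (2 : k) • ⁅e, b⁆ = 0 := by
      rw [two_smul]
      calc ⁅e, b⁆ + ⁅e, b⁆ = (⁅e, a⁆ + ⁅e, b⁆) - (⁅e, a⁆ + -⁅e, b⁆) := by abel
        _ = 0 := by rw [e1, e2, sub_zero]
    exact (smul_eq_zero.mp e3).resolve_left (by norm_num)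
  rw [hb0, add_zero]
  exact haa

lemma core_iff (θ η : g ≃ₗ⁅k⁆ g) (hθθ : ∀ x, θ (θ x) = x) (hηη : ∀ x, η (η x) = x)
    (hθη : ∀ x, θ (η x) = η (θ x)) (Ga Gb Gc : Submodule k g)
    (ha : ∀ x, x ∈ Ga ↔ θ x = -x ∧ η x = x) (hb : ∀ x, x ∈ Gb ↔ θ x = x ∧ η x = -x)
    (hc : ∀ x, x ∈ Gc ↔ θ x = -x ∧ η x = -x) :
    (∃ x ∈ Ga, Submodule.map (ad k g x) Gb = Gc) ↔
      ∀ cs : Submodule k g, IsCartanSubspace k g Ga cs → IsCartanSubspace k g (Ga ⊔ Gc) cs :=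
  ⟨core_forward k g θ η hθθ hηη hθη Ga Gb Gc ha hb hc,
    core_backward k g θ η hθθ hηη hθη Ga Gb Gc ha hb hc⟩

/-- For any permutation `(α, β, γ)` of the indices `(01, 10, 11)`,
there exists `x ∈ g_α` with `[g_β, x] = g_γ` iff every Cartan subspace of `g_α` is also
a Cartan subspace of `g_α ⊕ g_γ`. -/
theorem ad_surjective_iff_cartanSubspace (σ₁ σ₂ : g ≃ₗ⁅k⁆ g)
    (hcomm : CommutingInvolutions k g σ₁ σ₂) :
    ∀ a b c : Bool × Bool,
      a ≠ (false, false) → b ≠ (false, false) → c ≠ (false, false) →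
      a ≠ b → a ≠ c → b ≠ c →
      ((∃ x ∈ qSpace k g σ₁ σ₂ a.1 a.2,
          Submodule.map (ad k g x) (qSpace k g σ₁ σ₂ b.1 b.2) =
            qSpace k g σ₁ σ₂ c.1 c.2) ↔
        ∀ cs : Submodule k g, IsCartanSubspace k g (qSpace k g σ₁ σ₂ a.1 a.2) cs →
          IsCartanSubspace k g
            (qSpace k g σ₁ σ₂ a.1 a.2 ⊔ qSpace k g σ₁ σ₂ c.1 c.2) cs) := by
  obtain ⟨h1, h2, h12⟩ := hcomm
  have hmem : ∀ (i j : Bool) (x : g), x ∈ qSpace k g σ₁ σ₂ i j ↔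
      σ₁ x = (if i then -1 else 1 : k) • x ∧ σ₂ x = (if j then -1 else 1 : k) • x := by
    intro i j x
    rw [qSpace, Submodule.mem_inf, eigSub, eigSub, Module.End.mem_eigenspace_iff,
      Module.End.mem_eigenspace_iff]
    rfl
  let σ₃ : g ≃ₗ⁅k⁆ g := σ₁.trans σ₂
  have h3a : ∀ x, σ₃ x = σ₂ (σ₁ x) := fun x ↦ rfl
  have h3 : ∀ x, σ₃ (σ₃ x) = x := by
    intro x; rw [h3a, h3a, h12, h1, h2]
  have h13 : ∀ x, σ₁ (σ₃ x) = σ₃ (σ₁ x) := by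
    intro x; rw [h3a, h3a, h12]
  have h23 : ∀ x, σ₂ (σ₃ x) = σ₃ (σ₂ x) := by
    intro x; rw [h3a, h3a, h12]
  have m01 : ∀ x, x ∈ qSpace k g σ₁ σ₂ false true ↔ σ₁ x = x ∧ σ₂ x = -x := by
    intro x; rw [hmem]; simp
  have m10 : ∀ x, x ∈ qSpace k g σ₁ σ₂ true false ↔ σ₁ x = -x ∧ σ₂ x = x := by
    intro x; rw [hmem]; simp
  have m11 : ∀ x, x ∈ qSpace k g σ₁ σ₂ true true ↔ σ₁ x = -x ∧ σ₂ x = -x := by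
    intro x; rw [hmem]; simp
  have a1 : ∀ x, σ₁ x = x → σ₃ x = σ₂ x := fun x h ↦ by rw [h3a, h]
  have a2 : ∀ x, σ₁ x = -x → σ₃ x = -σ₂ x := fun x h ↦ by rw [h3a, h, map_neg]
  have b1 : ∀ x, σ₂ x = x → σ₃ x = σ₁ x := fun x h ↦ by rw [h3a, ← h12, h]
  have b2 : ∀ x, σ₂ x = -x → σ₃ x = -σ₁ x := fun x h ↦ by rw [h3a, ← h12, h, map_neg]
  -- membership in terms of the third involution
  have m01a : ∀ x, x ∈ qSpace k g σ₁ σ₂ false true ↔ σ₃ x = -x ∧ σ₁ x = x := by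
    intro x; rw [m01]
    constructor
    · rintro ⟨u, v⟩; exact ⟨by rw [a1 x u, v], u⟩
    · rintro ⟨u, v⟩; exact ⟨v, by rw [← a1 x v, u]⟩
  have m01b : ∀ x, x ∈ qSpace k g σ₁ σ₂ false true ↔ σ₂ x = -x ∧ σ₃ x = -x := by
    intro x; rw [m01]
    constructor
    · rintro ⟨u, v⟩; exact ⟨v, by rw [a1 x u, v]⟩
    · rintro ⟨u, v⟩
      refine ⟨?_, u⟩
      rw [b2 x u] at v; exact neg_injective v
  have m10a : ∀ x, x ∈ qSpace k g σ₁ σ₂ true false ↔ σ₃ x = -x ∧ σ₂ x = x := by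
    intro x; rw [m10]
    constructor
    · rintro ⟨u, v⟩; exact ⟨by rw [b1 x v, u], v⟩
    · rintro ⟨u, v⟩; exact ⟨by rw [← b1 x v, u], v⟩
  have m10b : ∀ x, x ∈ qSpace k g σ₁ σ₂ true false ↔ σ₁ x = -x ∧ σ₃ x = -x := by
    intro x; rw [m10]
    constructor
    · rintro ⟨u, v⟩; exact ⟨u, by rw [b1 x v, u]⟩
    · rintro ⟨u, v⟩
      refine ⟨u, ?_⟩
      rw [a2 x u] at v; exact neg_injective v
  have m11a : ∀ x, x ∈ qSpace k g σ₁ σ₂ true true ↔ σ₁ x = -x ∧ σ₃ x = x := by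
    intro x; rw [m11]
    constructor
    · rintro ⟨u, v⟩; exact ⟨u, by rw [b2 x v, u, neg_neg]⟩
    · rintro ⟨u, v⟩
      refine ⟨u, ?_⟩
      rw [a2 x u] at v; rw [← v, neg_neg]; rw [v]
  have m11b : ∀ x, x ∈ qSpace k g σ₁ σ₂ true true ↔ σ₂ x = -x ∧ σ₃ x = x := by
    intro x; rw [m11]
    constructor
    · rintro ⟨u, v⟩; exact ⟨v, by rw [b2 x v, u, neg_neg]⟩
    · rintro ⟨u, v⟩
      refine ⟨?_, u⟩
      rw [b2 x u] at v; rw [← neg_eq_iff_eq_neg]; exact v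
  have sw : ∀ {P Q R : Prop}, (R ↔ P ∧ Q) → (R ↔ Q ∧ P) := fun h ↦ h.trans and_comm
  rintro ⟨a, a'⟩ ⟨b, b'⟩ ⟨c, c'⟩ na nb nc nab nac nbc
  cases a <;> cases a' <;> cases b <;> cases b' <;> cases c <;> cases c' <;>
    first
    | exact absurd rfl na
    | exact absurd rfl nb
    | exact absurd rfl nc
    | exact absurd rfl nab
    | exact absurd rfl nac
    | exact absurd rfl nbc
    | exact core_iff k g σ₁ σ₂ h1 h2 h12 _ _ _ m10 m01 m11
    | exact core_iff k g σ₂ σ₁ h2 h1 (fun x ↦ (h12 x).symm) _ _ _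
        (fun x ↦ sw (m01 x)) (fun x ↦ sw (m10 x)) (fun x ↦ sw (m11 x))
    | exact core_iff k g σ₃ σ₁ h3 h1 (fun x ↦ (h13 x).symm) _ _ _
        m01a (fun x ↦ sw (m11a x)) (fun x ↦ sw (m10b x))
    | exact core_iff k g σ₁ σ₃ h1 h3 h13 _ _ _ m11a (fun x ↦ sw (m01a x)) m10b
    | exact core_iff k g σ₃ σ₂ h3 h2 (fun x ↦ (h23 x).symm) _ _ _
        m10a (fun x ↦ sw (m11b x)) (fun x ↦ sw (m01b x))
    | exact core_iff k g σ₂ σ₃ h2 h3 h23 _ _ _ m11b (fun x ↦ sw (m10a x)) m01b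
end
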